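/- arXiv:2512.08554 — 3 statements merged into one kernel-verified Lean document; each statement's English description precedes it below -/
import Mathlib

section
/- Let G be a finite simple chordal graph and let k be a positive integer. Every integer point of the dilation k·P_P(G) of the induced path polytope P_P(G) of G is the sum of k extended incidence vectors of induced paths of G; in particular the induced path polytope of a chordal graph has the integer decomposition property. -/
open SimpleGraph Finset
open scoped Classical

/-- A graph has a hole if some set of vertices induces a cycle of length at least 4. -/
def SimpleGraph.HasHole {V : Type*} (G : SimpleGraph V) : Prop :=
  ∃ (W : Set V) (n : ℕ), 4 ≤ n ∧ Nonempty (G.induce W ≃g SimpleGraph.cycleGraph n)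

/-- A graph is chordal if it has no hole. -/
def SimpleGraph.Chordal {V : Type*} (G : SimpleGraph V) : Prop := ¬ G.HasHole

/-- `W` induces a tree in `G`. -/
def SimpleGraph.IsInducedTree {V : Type*} (G : SimpleGraph V) (W : Finset V) : Prop :=
  (G.induce (W : Set V)).IsTree

/-- `W` induces a path in `G`. -/
def SimpleGraph.IsInducedPath {V : Type*} (G : SimpleGraph V) (W : Finset V) : Prop :=
  ∃ n : ℕ, 1 ≤ n ∧ Nonempty (G.induce (W : Set V) ≃g SimpleGraph.pathGraph n)

/-- The extended incidence vector of a vertex set `W`. -/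
noncomputable def SimpleGraph.xi {V : Type*} (G : SimpleGraph V) (W : Finset V) :
    (V → ℝ) × (Sym2 V → ℝ) :=
  (fun v => if v ∈ W then 1 else 0,
   fun e => if e ∈ G.edgeSet ∧ ∀ v ∈ e, v ∈ W then 1 else 0)

/-- `K` is a maximal clique of `G`. -/
def SimpleGraph.IsMaxCliqueF {V : Type*} (G : SimpleGraph V) (K : Finset V) : Prop :=
  G.IsClique (K : Set V) ∧ ∀ K' : Finset V, G.IsClique (K' : Set V) → K ⊆ K' → K' = K

/-- The induced tree cone `C_T(G)`. -/
noncomputable def SimpleGraph.inducedTreeCone {V : Type*} (G : SimpleGraph V) :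
    Set ((V → ℝ) × (Sym2 V → ℝ)) :=
  {p | (∀ v, 0 ≤ p.1 v) ∧ (∀ e, 0 ≤ p.2 e) ∧ (∀ e, e ∉ G.edgeSet → p.2 e = 0) ∧
    ∀ (v : V) (K : Finset V), G.IsMaxCliqueF K → v ∈ K →
      ∑ u ∈ K.erase v, p.2 s(u, v) ≤ p.1 v}

/-- The set of vertices outside `S` complete to `S`. -/
noncomputable def SimpleGraph.completeTo {V : Type*} [Fintype V] (G : SimpleGraph V)
    (S : Finset V) : Finset V :=
  Finset.univ.filter fun v => v ∉ S ∧ ∀ u ∈ S, G.Adj v u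

/-- The induced path cone `C_P(G)`. -/
noncomputable def SimpleGraph.inducedPathCone {V : Type*} [Fintype V] (G : SimpleGraph V) :
    Set ((V → ℝ) × (Sym2 V → ℝ)) :=
  {p | (∀ v, 0 ≤ p.1 v) ∧ (∀ e, 0 ≤ p.2 e) ∧ (∀ e, e ∉ G.edgeSet → p.2 e = 0) ∧
    ∀ (w : V) (K : Finset V), (K : Set V) ⊆ G.neighborSet w → G.IsClique (K : Set V) →
      ∑ u ∈ G.completeTo (insert w K), p.2 s(w, u) + 2 * ∑ u ∈ K, p.2 s(w, u) ≤ 2 * p.1 w}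

/-- The polytope `T(G)`: intersection of `C_T(G)` with the hyperplane `x(V) - y(E) = 1`. -/
noncomputable def SimpleGraph.treePolyT {V : Type*} [Fintype V] (G : SimpleGraph V) :
    Set ((V → ℝ) × (Sym2 V → ℝ)) :=
  {p ∈ G.inducedTreeCone | ∑ v : V, p.1 v - ∑ e : Sym2 V, p.2 e = 1}

/-- The polytope `P(G)`: intersection of `C_P(G)` with the hyperplane `x(V) - y(E) = 1`. -/
noncomputable def SimpleGraph.pathPolyP {V : Type*} [Fintype V] (G : SimpleGraph V) :
    Set ((V → ℝ) × (Sym2 V → ℝ)) :=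
  {p ∈ G.inducedPathCone | ∑ v : V, p.1 v - ∑ e : Sym2 V, p.2 e = 1}

/-- The induced tree polytope: convex hull of extended incidence vectors of induced trees. -/
noncomputable def SimpleGraph.inducedTreePolytope {V : Type*} (G : SimpleGraph V) :
    Set ((V → ℝ) × (Sym2 V → ℝ)) :=
  convexHull ℝ {p | ∃ W : Finset V, G.IsInducedTree W ∧ p = G.xi W}

/-- The induced path polytope: convex hull of extended incidence vectors of induced paths. -/
noncomputable def SimpleGraph.inducedPathPolytope {V : Type*} (G : SimpleGraph V) :
    Set ((V → ℝ) × (Sym2 V → ℝ)) :=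
  convexHull ℝ {p | ∃ W : Finset V, G.IsInducedPath W ∧ p = G.xi W}

/-- `p` is an extreme point of `s`: it cannot be written as the midpoint of two
distinct points of `s`. -/
def IsExtremePt {E : Type*} [AddCommGroup E] [Module ℝ E] (s : Set E) (p : E) : Prop :=
  p ∈ s ∧ ∀ q r : E, q ∈ s → r ∈ s → p = (2⁻¹ : ℝ) • (q + r) → q = r

/-- `u` is an extremity of the induced path `W` (degree at most 1 in the induced subgraph). -/
noncomputable def SimpleGraph.IsExtremity {V : Type*} (G : SimpleGraph V) (u : V)
    (W : Finset V) : Prop :=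
  u ∈ W ∧ (W.filter fun w => G.Adj u w).card ≤ 1

/-- The neighborhood of `v` as a `Finset`. -/
noncomputable def SimpleGraph.nbrF {V : Type*} [Fintype V] (G : SimpleGraph V) (v : V) :
    Finset V :=
  Finset.univ.filter fun u => G.Adj v u

/-- `K` defines an orbit of `w`. -/
noncomputable def SimpleGraph.DefinesOrbit {V : Type*} [Fintype V] (G : SimpleGraph V)
    (w : V) (K : Finset V) : Prop :=
  (K : Set V) ⊆ G.neighborSet w ∧ G.IsClique (K : Set V) ∧
    ¬ ∃ K' : Finset V, (K' : Set V) ⊆ G.neighborSet w ∧ G.IsClique (K' : Set V) ∧ K ⊂ K' ∧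
      insert w K ∪ G.completeTo (insert w K) ⊆ insert w K' ∪ G.completeTo (insert w K')

/-- An adjacency-reflecting injection of a cycle of length at least 4 exhibits a hole. -/
theorem SimpleGraph.Chordal.false_of_cycle {V : Type*} {G : SimpleGraph V} (hG : G.Chordal)
    {n : ℕ} (hn : 4 ≤ n) (f : Fin n → V) (hinj : Function.Injective f)
    (hadj : ∀ i j, G.Adj (f i) (f j) ↔ (cycleGraph n).Adj i j) : False := by
  refine hG ⟨Set.range f, n, hn, ⟨RelIso.symm ⟨Equiv.ofInjective f hinj, ?_⟩⟩⟩
  intro a b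
  simpa using hadj a b

/-- In a chordal graph, a walk all of whose consecutive triples are induced paths is an
induced path. -/
theorem SimpleGraph.Chordal.induced_of_local {V : Type*} {G : SimpleGraph V} (hG : G.Chordal)
    {n : ℕ} {p : ℕ → V} (h1 : ∀ i, i + 1 < n → G.Adj (p i) (p (i + 1)))
    (h2 : ∀ i, i + 2 < n → p i ≠ p (i + 2) ∧ ¬ G.Adj (p i) (p (i + 2))) :
    ∀ l i, i + (l + 1) < n →
      p i ≠ p (i + (l + 1)) ∧ (G.Adj (p i) (p (i + (l + 1))) → l = 0) := by
  intro l
  induction l using Nat.strong_induction_on with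
  | _ l ih =>
    intro i hi
    rcases l with _ | _ | l
    · exact ⟨(h1 i hi).ne, fun _ => rfl⟩
    · exact ⟨(h2 i hi).1, fun h => absurd h (h2 i hi).2⟩
    · have hne : p i ≠ p (i + (l + 2 + 1)) := by
        intro h
        have h3 := (ih (l + 1) (by omega) i (by omega)).2
        rw [h] at h3
        have := h3 (h1 (i + (l + 1 + 1)) (by omega)).symm
        omega
      refine ⟨hne, fun hA => False.elim ?_⟩
      have key : ∀ a b : ℕ, a < b → b < l + 4 → p (i + a) ≠ p (i + b) ∧
          (G.Adj (p (i + a)) (p (i + b)) ↔ b = a + 1 ∨ (a = 0 ∧ b = l + 3)) := by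
        intro a b hab hb
        by_cases hc : a = 0 ∧ b = l + 3
        · obtain ⟨rfl, rfl⟩ := hc
          exact ⟨hne, by simpa using hA⟩
        · obtain ⟨m, rfl⟩ : ∃ m, b = a + (m + 1) := ⟨b - a - 1, by omega⟩
          have h3 := ih m (by omega) (i + a) (by omega)
          rw [add_assoc] at h3
          refine ⟨h3.1, fun h => Or.inl (by have := h3.2 h; omega), ?_⟩
          rintro (h | h)
          · obtain rfl : m = 0 := by omega
            simpa [add_assoc] using h1 (i + a) (by omega)
          · exact absurd h hc
      have cyc : ∀ a b : Fin (l + 4), a < b →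
          ((cycleGraph (l + 4)).Adj a b ↔ b.val = a.val + 1 ∨ (a.val = 0 ∧ b.val = l + 3)) := by
        intro a b hab
        rw [cycleGraph_adj', Fin.coe_sub_iff_lt.2 hab, Fin.coe_sub_iff_le.2 hab.le]
        have := a.2
        have := b.2
        rw [Fin.lt_def] at hab
        omega
      refine hG.false_of_cycle (n := l + 4) (by omega) (fun a => p (i + a)) ?_ ?_
      · intro a b hab
        rcases lt_trichotomy a b with h | h | h
        · exact absurd hab (key a b h b.2).1
        · exact h
        · exact absurd hab.symm (key b a h a.2).1
      · intro a b
        rcases lt_trichotomy a b with h | h | h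
        · rw [cyc a b h, (key a b h b.2).2]
        · simp [h]
        · rw [G.adj_comm, (cycleGraph _).adj_comm, cyc b a h, (key b a h a.2).2]

/-- A chordal graph has no induced 4-cycle `a c b d`. -/
theorem SimpleGraph.Chordal.false_of_square {V : Type*} {G : SimpleGraph V} (hG : G.Chordal)
    {a b c d : V} (hab : a ≠ b) (hab' : ¬ G.Adj a b) (hcd : c ≠ d) (hcd' : ¬ G.Adj c d)
    (hac : G.Adj a c) (had : G.Adj a d) (hbc : G.Adj b c) (hbd : G.Adj b d) : False := by
  refine hG.false_of_cycle (n := 4) le_rfl ![a, c, b, d] ?_ ?_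
  · intro i j
    have := hac.ne
    have := had.ne
    have := hbc.ne
    have := hbd.ne
    fin_cases i <;> fin_cases j <;> simp_all <;> grind
  · intro i j
    rw [cycleGraph_adj']
    fin_cases i <;> fin_cases j <;> simp_all [G.adj_comm] <;> grind [G.adj_comm]

/-- An induced path is the image of a sequence of distinct vertices whose adjacencies are exactly
those between consecutive terms. -/
theorem SimpleGraph.isInducedPath_iff {V : Type*} {G : SimpleGraph V} {W : Finset V} :
    G.IsInducedPath W ↔ ∃ (n : ℕ) (p : ℕ → V), 1 ≤ n ∧
      (∀ i j, i < n → j < n → p i = p j → i = j) ∧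
      (∀ i j, i < n → j < n → (G.Adj (p i) (p j) ↔ i + 1 = j ∨ j + 1 = i)) ∧
      W = (Finset.range n).image p := by
  constructor
  · rintro ⟨n, hn, ⟨φ⟩⟩
    let q : Fin n → V := fun i => (φ.symm i : V)
    have hq : ∀ i (hi : i < n), (if h : i < n then q ⟨i, h⟩ else q ⟨0, hn⟩) = q ⟨i, hi⟩ :=
      fun i hi => dif_pos hi
    refine ⟨n, fun i => if h : i < n then q ⟨i, h⟩ else q ⟨0, hn⟩, hn, ?_, ?_, ?_⟩
    · intro i j hi hj h
      simp only [hq i hi, hq j hj] at h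
      simpa using φ.symm.injective (Subtype.ext h)
    · intro i j hi hj
      simp only [hq i hi, hq j hj]
      have := φ.symm.map_rel_iff (a := ⟨i, hi⟩) (b := ⟨j, hj⟩)
      rw [pathGraph_adj] at this
      simpa [q] using this
    · ext v
      simp only [Finset.mem_image, Finset.mem_range]
      constructor
      · intro hv
        refine ⟨φ ⟨v, hv⟩, (φ ⟨v, hv⟩).2, ?_⟩
        simp [q]
      · rintro ⟨i, hi, rfl⟩
        rw [hq i hi]
        exact (φ.symm ⟨i, hi⟩).2
  · rintro ⟨n, p, hn, hinj, hadj, rfl⟩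
    refine ⟨n, hn, ⟨RelIso.symm ⟨Equiv.ofBijective
      (fun i : Fin n => ⟨p i, by simpa using ⟨i, i.2, rfl⟩⟩) ⟨?_, ?_⟩, ?_⟩⟩⟩
    · intro i j h
      exact Fin.ext (hinj i j i.2 j.2 (congrArg Subtype.val h))
    · rintro ⟨v, hv⟩
      obtain ⟨i, hi, rfl⟩ : ∃ i, i < n ∧ p i = v := by simpa using hv
      exact ⟨⟨i, hi⟩, rfl⟩
    · intro a b
      rw [pathGraph_adj]
      exact hadj a b a.2 b.2

/-- If all non-isolated vertices of a finite graph lie in one component, then the number of odd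
components exceeds the number of isolated vertices by at most one. -/
theorem SimpleGraph.ncard_oddComponents_le {W : Type*} [Finite W] (H : SimpleGraph W)
    (h : ∀ a a' b b', H.Adj a a' → H.Adj b b' → H.Reachable a b) :
    H.oddComponents.ncard ≤ {v | ∀ w, ¬ H.Adj v w}.ncard + 1 := by
  by_cases hE : ∃ a a', H.Adj a a'
  · obtain ⟨a, a', haa⟩ := hE
    have hsub : H.oddComponents ⊆
        insert (H.connectedComponentMk a) (H.connectedComponentMk '' {v | ∀ w, ¬ H.Adj v w}) := by
      intro c _
      induction c using ConnectedComponent.ind with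
      | _ v =>
        by_cases hv : ∃ w, H.Adj v w
        · obtain ⟨w, hw⟩ := hv
          exact Or.inl (ConnectedComponent.sound (h v w a a' hw haa))
        · exact Or.inr ⟨v, by simpa using hv, rfl⟩
    calc _ ≤ _ := Set.ncard_le_ncard hsub (Set.toFinite _)
      _ ≤ _ := Set.ncard_insert_le _ _
      _ ≤ _ := Nat.add_le_add_right (Set.ncard_image_le (Set.toFinite _)) 1
  · have hsub : H.oddComponents ⊆ H.connectedComponentMk '' {v | ∀ w, ¬ H.Adj v w} := by
      intro c _
      induction c using ConnectedComponent.ind with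
      | _ v => exact ⟨v, fun w hw => hE ⟨v, w, hw⟩, rfl⟩
    calc _ ≤ _ := Set.ncard_le_ncard hsub (Set.toFinite _)
      _ ≤ _ := Set.ncard_image_le (Set.toFinite _)
      _ ≤ _ := Nat.le_succ _

/-- The graph obtained from `C` by adding universal vertices indexed by `U`. -/
def SimpleGraph.addUniversal {T : Type*} (C : SimpleGraph T) (U : Type*) :
    SimpleGraph (T ⊕ U) where
  Adj a b := a ≠ b ∧ ∀ t t', a = Sum.inl t → b = Sum.inl t' → C.Adj t t'
  symm := ⟨fun _ _ h => ⟨h.1.symm, fun t t' ht ht' => (h.2 t' t ht' ht).symm⟩⟩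
  loopless := ⟨fun _ h => h.1 rfl⟩

theorem SimpleGraph.addUniversal_adj_inl {T U : Type*} {C : SimpleGraph T} {t t' : T} :
    (C.addUniversal U).Adj (Sum.inl t) (Sum.inl t') ↔ C.Adj t t' :=
  ⟨fun h => h.2 t t' rfl rfl, fun h => ⟨fun e => h.ne (Sum.inl.inj e), by
    rintro _ _ ⟨⟩ ⟨⟩
    exact h⟩⟩

theorem SimpleGraph.addUniversal_adj_inr {T U : Type*} {C : SimpleGraph T} {u : U} {a : T ⊕ U}
    (h : a ≠ Sum.inr u) : (C.addUniversal U).Adj a (Sum.inr u) :=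
  ⟨h, fun _ _ _ h' => by simp at h'⟩

/-- A `2K₂`-free graph on `d` vertices satisfying the fractional bound `2|I| + |R| ≤ 2x` acquires
a perfect matching when `2x - d` universal vertices are added. -/
theorem SimpleGraph.exists_isPerfectMatching_addUniversal {T : Type*} [Fintype T]
    (C : SimpleGraph T)
    (h2 : ∀ a b c d, C.Adj a b → C.Adj c d → a = c ∨ a = d ∨ b = c ∨ b = d ∨
      C.Adj a c ∨ C.Adj a d ∨ C.Adj b c ∨ C.Adj b d)
    (x : ℕ)
    (hx : ∀ I R : Finset T, Disjoint I R → (∀ a ∈ I, ∀ b, b ∈ I ∨ b ∈ R → ¬ C.Adj a b) →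
      2 * #I + #R ≤ 2 * x) :
    ∃ M : (C.addUniversal (Fin (2 * x - Fintype.card T))).Subgraph, M.IsPerfectMatching := by
  have hd : Fintype.card T ≤ 2 * x := by
    simpa using hx ∅ Finset.univ (by simp) (by simp)
  set C' := C.addUniversal (Fin (2 * x - Fintype.card T)) with hC'
  rw [SimpleGraph.tutte]
  intro S hS
  unfold IsTutteViolator at hS
  set H := ((⊤ : C'.Subgraph).deleteVerts S).coe with hH
  have hadj : ∀ a b : ((⊤ : C'.Subgraph).deleteVerts S).verts,
      H.Adj a b ↔ C'.Adj a.1 b.1 := by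
    intro a b
    have ha := a.2
    have hb := b.2
    simp only [Subgraph.deleteVerts_verts, Subgraph.verts_top, Set.mem_sdiff] at ha hb
    simp [hH, ha.2, hb.2]
  have hmem : ∀ a, a ∈ ((⊤ : C'.Subgraph).deleteVerts S).verts ↔ a ∉ S := by
    intro a
    simp
  have hcard : ((⊤ : C'.Subgraph).deleteVerts S).verts.ncard + S.ncard = 2 * x := by
    have h1 : ((⊤ : C'.Subgraph).deleteVerts S).verts = Sᶜ := by
      ext a
      simp
    rw [h1, add_comm, Set.ncard_add_ncard_compl]
    simp
    omega
  have hpar := odd_ncard_oddComponents H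
  rw [Nat.card_coe_set_eq] at hpar
  have hlt : S.ncard + 2 ≤ H.oddComponents.ncard := by
    by_contra hcon
    have heq : H.oddComponents.ncard = S.ncard + 1 := by omega
    rw [heq, Nat.odd_iff, Nat.odd_iff] at hpar
    omega
  by_cases hz : ∃ z, Sum.inr z ∉ S
  · obtain ⟨z, hz⟩ := hz
    have hsub : H.oddComponents ⊆ {H.connectedComponentMk ⟨Sum.inr z, (hmem _).2 hz⟩} := by
      intro c _
      induction c using ConnectedComponent.ind with
      | _ v =>
        refine ConnectedComponent.sound ?_
        by_cases hv : v.1 = Sum.inr z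
        · have : v = ⟨Sum.inr z, (hmem _).2 hz⟩ := Subtype.ext hv
          rw [this]
        · exact Adj.reachable ((hadj _ _).2 (addUniversal_adj_inr hv))
    have := Set.ncard_le_ncard hsub (Set.toFinite _)
    rw [Set.ncard_singleton] at this
    omega
  · push Not at hz
    have hinl : ∀ a : ((⊤ : C'.Subgraph).deleteVerts S).verts, ∃ t, a.1 = Sum.inl t := by
      rintro ⟨a | a, ha⟩
      · exact ⟨a, rfl⟩
      · exact absurd (hz a) ((hmem _).1 ha)
    set A : Finset T := Finset.univ.filter fun t => Sum.inl t ∉ S with hA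
    set I : Finset T := A.filter fun t => ∀ t' ∈ A, ¬ C.Adj t t' with hI
    have hIA : I ⊆ A := Finset.filter_subset _ _
    have hAcard : #A = ((⊤ : C'.Subgraph).deleteVerts S).verts.ncard := by
      have : ((⊤ : C'.Subgraph).deleteVerts S).verts = Sum.inl '' (A : Set T) := by
        ext a
        rw [hmem]
        constructor
        · intro ha
          obtain ⟨t, ht⟩ := hinl ⟨a, (hmem a).2 ha⟩
          exact ⟨t, by simpa [hA, ← ht] using ha, ht.symm⟩
        · rintro ⟨t, ht, rfl⟩
          simpa [hA] using ht
      rw [this, Set.ncard_image_of_injective _ Sum.inl_injective, Set.ncard_coe_finset]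
    have hbound := hx I (A \ I) Finset.disjoint_sdiff (by
      intro a ha b hb
      rw [← Finset.mem_union, Finset.union_sdiff_of_subset hIA] at hb
      exact (Finset.mem_filter.1 ha).2 b hb)
    rw [Finset.card_sdiff_of_subset hIA] at hbound
    have hIA' := Finset.card_le_card hIA
    have hcount := H.ncard_oddComponents_le (by
      intro a a' b b' haa hbb
      obtain ⟨s, hs⟩ := hinl a
      obtain ⟨s', hs'⟩ := hinl a'
      obtain ⟨t, ht⟩ := hinl b
      obtain ⟨t', ht'⟩ := hinl b'
      have e1 := haa
      have e2 := hbb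
      rw [hadj, hs, hs', addUniversal_adj_inl] at e1
      rw [hadj, ht, ht', addUniversal_adj_inl] at e2
      have lift : ∀ (u v : ((⊤ : C'.Subgraph).deleteVerts S).verts) (p q : T),
          u.1 = Sum.inl p → v.1 = Sum.inl q → p = q ∨ C.Adj p q → H.Reachable u v := by
        rintro u v p q hu hv (h | h)
        · have : u = v := Subtype.ext (by rw [hu, hv, h])
          rw [this]
        · refine Adj.reachable ((hadj _ _).2 ?_)
          rw [hu, hv]
          exact addUniversal_adj_inl.2 h
      have ra := haa.reachable
      have rb := hbb.reachable
      rcases h2 s s' t t' e1 e2 with h | h | h | h | h | h | h | h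
      · exact lift a b _ _ hs ht (Or.inl h)
      · exact (lift a b' _ _ hs ht' (Or.inl h)).trans rb.symm
      · exact ra.trans (lift a' b _ _ hs' ht (Or.inl h))
      · exact (ra.trans (lift a' b' _ _ hs' ht' (Or.inl h))).trans rb.symm
      · exact lift a b _ _ hs ht (Or.inr h)
      · exact (lift a b' _ _ hs ht' (Or.inr h)).trans rb.symm
      · exact ra.trans (lift a' b _ _ hs' ht (Or.inr h))
      · exact (ra.trans (lift a' b' _ _ hs' ht' (Or.inr h))).trans rb.symm)
    have hiso : {v | ∀ w, ¬ H.Adj v w}.ncard ≤ #I := by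
      rw [← Set.ncard_image_of_injective _ Subtype.val_injective, ← Set.ncard_coe_finset I,
        ← Set.ncard_image_of_injective (I : Set T)
          (Sum.inl_injective (β := Fin (2 * x - Fintype.card T)))]
      refine Set.ncard_le_ncard ?_ (Set.toFinite _)
      rintro _ ⟨v, hv, rfl⟩
      obtain ⟨t, ht⟩ := hinl v
      have htS : Sum.inl t ∉ S := by
        rw [← ht]
        exact (hmem _).1 v.2
      refine ⟨t, ?_, ht.symm⟩
      simp only [hI, hA, Finset.coe_filter, Finset.mem_filter, Finset.mem_univ, true_and,
        Set.mem_ofPred_eq]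
      refine ⟨htS, fun t' ht' hadj' => hv ⟨Sum.inl t', (hmem _).2 ht'⟩ ((hadj _ _).2 ?_)⟩
      rw [ht]
      exact addUniversal_adj_inl.2 hadj'
    omega

/-- The vertices of a `2K₂`-free graph satisfying the fractional bound `2|I| + |R| ≤ 2x` can be
distributed into `x` classes, each of which is empty, a single vertex or an edge. -/
theorem SimpleGraph.exists_pairing {T : Type*} [Fintype T] (C : SimpleGraph T)
    (h2 : ∀ a b c d, C.Adj a b → C.Adj c d → a = c ∨ a = d ∨ b = c ∨ b = d ∨
      C.Adj a c ∨ C.Adj a d ∨ C.Adj b c ∨ C.Adj b d)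
    (x : ℕ)
    (hx : ∀ I R : Finset T, Disjoint I R → (∀ a ∈ I, ∀ b, b ∈ I ∨ b ∈ R → ¬ C.Adj a b) →
      2 * #I + #R ≤ 2 * x) :
    ∃ s : T → ℕ, (∀ a, s a < x) ∧ (∀ a b, s a = s b → a = b ∨ C.Adj a b) ∧
      ∀ a b c, s a = s b → s a = s c → a = b ∨ a = c ∨ b = c := by
  have hd : Fintype.card T ≤ 2 * x := by
    simpa using hx ∅ Finset.univ (by simp) (by simp)
  obtain ⟨M, hM⟩ := C.exists_isPerfectMatching_addUniversal h2 x hx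
  rw [Subgraph.isPerfectMatching_iff] at hM
  choose f hf hf' using hM
  have hff : ∀ v, f (f v) = v := fun v => (hf' _ v (hf v).symm).symm
  have hne : ∀ v, f v ≠ v := fun v => (M.adj_sub (hf v)).ne'
  let g : T ⊕ Fin (2 * x - Fintype.card T) → Sym2 (T ⊕ Fin (2 * x - Fintype.card T)) :=
    fun v => s(v, f v)
  have hg : ∀ v w, g v = g w → v = w ∨ v = f w := by
    intro v w h
    rcases Sym2.eq_iff.1 h with h | h
    · exact Or.inl h.1
    · exact Or.inr h.1
  have hcard : #(Finset.univ.image g) = x := by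
    have h1 := Finset.card_eq_sum_card_image g Finset.univ
    have h3 : ∀ e ∈ Finset.univ.image g, #{a ∈ Finset.univ | g a = e} = 2 := by
      intro e he
      obtain ⟨v, -, rfl⟩ := Finset.mem_image.1 he
      rw [Finset.card_eq_two]
      refine ⟨v, f v, (hne v).symm, ?_⟩
      ext w
      simp only [Finset.mem_filter, Finset.mem_univ, true_and, Finset.mem_insert,
        Finset.mem_singleton]
      refine ⟨hg w v, ?_⟩
      rintro (rfl | rfl)
      · rfl
      · simp only [g, hff, Sym2.eq_swap]
    rw [Finset.sum_congr rfl h3] at h1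
    simp at h1
    omega
  let φ := (Finset.univ.image g).equivFinOfCardEq hcard
  have hmem : ∀ a, g a ∈ Finset.univ.image g :=
    fun a => Finset.mem_image_of_mem _ (Finset.mem_univ a)
  let s : T → ℕ := fun a => (φ ⟨g (Sum.inl a), hmem _⟩ : ℕ)
  have hs : ∀ a b, s a = s b → a = b ∨ Sum.inl a = f (Sum.inl b) := by
    intro a b h
    have h4 := φ.injective (Fin.ext h)
    rcases hg _ _ (congrArg Subtype.val h4) with h | h
    · exact Or.inl (Sum.inl_injective h)
    · exact Or.inr h
  refine ⟨s, fun a => (φ _).2, fun a b h => ?_, fun a b c hab hac => ?_⟩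
  · refine (hs a b h).imp_right fun h => ?_
    have := M.adj_sub (hf (Sum.inl b))
    rw [← h, addUniversal_adj_inl] at this
    exact this.symm
  · rcases hs a b hab with h | h
    · exact Or.inl h
    · rcases hs a c hac with h' | h'
      · exact Or.inr (Or.inl h')
      · refine Or.inr (Or.inr (Sum.inl_injective (β := Fin (2 * x - Fintype.card T)) ?_))
        rw [← hff (Sum.inl b), ← h, h', hff]

/-- The bound `2|I| + |R| ≤ 2x` for sets of edge ends follows from the weight inequalities. -/
theorem SimpleGraph.two_mul_card_add_card_le {V : Type*} [Fintype V] (G : SimpleGraph V)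
    (y : V → ℕ) (x : ℕ)
    (hx : ∀ c : V → ℕ, (∀ u, c u ≤ 2) →
      (∀ u v, u ≠ v → ¬ G.Adj u v → c u + c v ≤ 2) → ∑ u, c u * y u ≤ 2 * x)
    (I R : Finset (Σ u : V, Fin (y u))) (hdisj : Disjoint I R)
    (hIR : ∀ i ∈ I, ∀ j, j ∈ I ∨ j ∈ R → i.1 ≠ j.1 → G.Adj i.1 j.1) :
    2 * #I + #R ≤ 2 * x := by
  obtain ⟨c, hc⟩ : ∃ c : V → ℕ, ∀ u, c u =
      if ∃ i ∈ I, i.1 = u then 2 else if ∃ r ∈ R, r.1 = u then 1 else 0 := ⟨_, fun _ => rfl⟩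
  have hc2 : ∀ u, c u ≤ 2 := by
    intro u
    simp only [hc]
    split_ifs <;> omega
  have hcI : ∀ i ∈ I, c i.1 = 2 := fun i hi => (hc _).trans (if_pos ⟨i, hi, rfl⟩)
  have hcR : ∀ r ∈ R, 1 ≤ c r.1 := by
    intro r hr
    have : ∃ r' ∈ R, r'.1 = r.1 := ⟨r, hr, rfl⟩
    simp only [hc, this, if_true]
    split_ifs <;> omega
  have hcase : ∀ u v, u ≠ v → ¬ G.Adj u v → (∃ i ∈ I, i.1 = u) → c v = 0 := by
    rintro _ v huv hadj ⟨i, hi, rfl⟩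
    have h1 : ¬ ∃ j ∈ I, j.1 = v := by
      rintro ⟨j, hj, rfl⟩
      exact hadj (hIR i hi j (Or.inl hj) huv)
    have h2 : ¬ ∃ j ∈ R, j.1 = v := by
      rintro ⟨j, hj, rfl⟩
      exact hadj (hIR i hi j (Or.inr hj) huv)
    simp only [hc, h1, h2, if_false]
  have hle1 : ∀ u, (¬ ∃ i ∈ I, i.1 = u) → c u ≤ 1 := by
    intro u hu
    simp only [hc, hu, if_false]
    split_ifs <;> omega
  have key := hx c hc2 (by
    intro u v huv hadj
    by_cases hu : ∃ i ∈ I, i.1 = u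
    · have := hcase u v huv hadj hu
      have := hc2 u
      omega
    · by_cases hv : ∃ i ∈ I, i.1 = v
      · have := hcase v u huv.symm (fun h => hadj h.symm) hv
        have := hc2 v
        omega
      · have := hle1 u hu
        have := hle1 v hv
        omega)
  have hsum : ∑ a : (Σ u : V, Fin (y u)), c a.1 = ∑ u, c u * y u := by
    rw [Fintype.sum_sigma]
    refine Finset.sum_congr rfl fun u _ => ?_
    simp [mul_comm]
  calc 2 * #I + #R = ∑ a ∈ I, 2 + ∑ a ∈ R, 1 := by simp [mul_comm]
    _ ≤ ∑ a ∈ I, c a.1 + ∑ a ∈ R, c a.1 :=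
      add_le_add (Finset.sum_le_sum fun i hi => (hcI i hi).ge) (Finset.sum_le_sum hcR)
    _ ≤ ∑ a : (Σ u : V, Fin (y u)), c a.1 := by
      rw [← Finset.sum_union hdisj]
      exact Finset.sum_le_sum_of_subset (Finset.subset_univ _)
    _ ≤ 2 * x := hsum.trans_le key

/-- Edge ends, `y u` of which lead to the vertex `u` of a chordal graph, can be distributed into `x`
slots, each holding at most two ends, and no two ends leading to equal or adjacent vertices, if
`∑ u, c u * y u ≤ 2 * x` for all weights `c ≤ 2` which sum to at most 2 on each pair of distinct
nonadjacent vertices. -/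
theorem SimpleGraph.Chordal.exists_slots {V : Type*} [Fintype V] {G : SimpleGraph V}
    (hG : G.Chordal) (y : V → ℕ) (x : ℕ)
    (hx : ∀ c : V → ℕ, (∀ u, c u ≤ 2) →
      (∀ u v, u ≠ v → ¬ G.Adj u v → c u + c v ≤ 2) → ∑ u, c u * y u ≤ 2 * x) :
    ∃ s : V → ℕ → ℕ, (∀ u m, m < y u → s u m < x) ∧
      (∀ u m v m', m < y u → m' < y v → s u m = s v m' →
        (u = v ∧ m = m') ∨ (u ≠ v ∧ ¬ G.Adj u v)) ∧
      ∀ u m u' m' u'' m'', m < y u → m' < y u' → m'' < y u'' → s u m = s u' m' →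
        s u m = s u'' m'' →
        (u = u' ∧ m = m') ∨ (u = u'' ∧ m = m'') ∨ (u' = u'' ∧ m' = m'') := by
  let C : SimpleGraph (Σ u : V, Fin (y u)) :=
    { Adj := fun a b => a.1 ≠ b.1 ∧ ¬ G.Adj a.1 b.1
      symm := ⟨fun a b h => ⟨h.1.symm, fun h' => h.2 h'.symm⟩⟩
      loopless := ⟨fun a h => h.1 rfl⟩ }
  have hC : ∀ a b, C.Adj a b ↔ a.1 ≠ b.1 ∧ ¬ G.Adj a.1 b.1 := fun a b => Iff.rfl
  obtain ⟨s, hs1, hs2, hs3⟩ := C.exists_pairing (x := x) (by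
    intro a b c d hab hcd
    by_contra! hcon
    obtain ⟨-, -, -, -, hac, had, hbc, hbd⟩ := hcon
    simp only [hC, not_and, not_not] at hab hcd hac had hbc hbd
    by_cases e1 : a.1 = c.1
    · exact hab.2 (e1 ▸ (hbc (e1 ▸ hab.1.symm)).symm)
    by_cases e2 : a.1 = d.1
    · exact hab.2 (e2 ▸ (hbd (e2 ▸ hab.1.symm)).symm)
    by_cases e3 : b.1 = c.1
    · exact hab.2 (e3 ▸ hac e1)
    by_cases e4 : b.1 = d.1
    · exact hab.2 (e4 ▸ had e2)
    exact hG.false_of_square hab.1 hab.2 hcd.1 hcd.2 (hac e1) (had e2) (hbc e3) (hbd e4))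
      (fun I R hdisj hIR =>
    G.two_mul_card_add_card_le y x hx I R hdisj fun i hi j hj huv => not_not.1 fun hadj =>
      hIR i hi j hj ⟨huv, hadj⟩)
  let s' : V → ℕ → ℕ := fun u m => if h : m < y u then s ⟨u, ⟨m, h⟩⟩ else 0
  have hs' : ∀ u m (h : m < y u), s' u m = s ⟨u, ⟨m, h⟩⟩ := fun u m h => dif_pos h
  have hinj : ∀ u m v m' (h : m < y u) (h' : m' < y v),
      (⟨u, ⟨m, h⟩⟩ : Σ u : V, Fin (y u)) = ⟨v, ⟨m', h'⟩⟩ → u = v ∧ m = m' := by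
    rintro u m v m' h h' e
    obtain ⟨rfl, e⟩ := Sigma.mk.inj_iff.1 e
    exact ⟨rfl, congrArg Fin.val (eq_of_heq e)⟩
  refine ⟨s', fun u m h => ?_, fun u m v m' h h' e => ?_,
    fun u m u' m' u'' m'' h h' h'' e e' => ?_⟩
  · rw [hs' u m h]
    exact hs1 _
  · rw [hs' u m h, hs' v m' h'] at e
    exact (hs2 _ _ e).imp (hinj _ _ _ _ h h') id
  · rw [hs' u m h] at e e'
    rw [hs' u' m' h'] at e
    rw [hs' u'' m'' h''] at e'
    exact (hs3 _ _ _ e e').imp (hinj _ _ _ _ h h')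
      (Or.imp (hinj _ _ _ _ h h'') (hinj _ _ _ _ h' h''))

/-- Let `Γ` be a graph of maximum degree 2 over a chordal graph `G` in which the two neighbours of
each vertex lie over distinct nonadjacent vertices. Every nonempty closed set of vertices of `Γ`
contains a component of `Γ` which maps isomorphically onto an induced path of `G`. -/
theorem SimpleGraph.Chordal.exists_component {V N : Type*} [Fintype V] {G : SimpleGraph V}
    (hG : G.Chordal) (Γ : SimpleGraph N) (π : N → V)
    (hhom : ∀ a b, Γ.Adj a b → G.Adj (π a) (π b))
    (hloc : ∀ a b c, Γ.Adj a b → Γ.Adj a c → b ≠ c → π b ≠ π c ∧ ¬ G.Adj (π b) (π c))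
    (hdeg : ∀ a b c d, Γ.Adj a b → Γ.Adj a c → Γ.Adj a d → b = c ∨ b = d ∨ c = d)
    (S : Finset N) (hS : ∀ a ∈ S, ∀ b, Γ.Adj a b → b ∈ S) (hne : S.Nonempty) :
    ∃ (n : ℕ) (p : ℕ → N), 1 ≤ n ∧ (∀ i, i < n → p i ∈ S) ∧
      (∀ i, i + 1 < n → Γ.Adj (p i) (p (i + 1))) ∧
      (∀ i b, i < n → Γ.Adj (p i) b → ∃ j, j < n ∧ b = p j) ∧
      (∀ i j, i < n → j < n → π (p i) = π (p j) → i = j) ∧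
      (∀ i j, i < n → j < n → (G.Adj (π (p i)) (π (p j)) ↔ i + 1 = j ∨ j + 1 = i)) := by
  let Ch : ℕ → Prop := fun n => ∃ p : ℕ → N, (∀ i, i < n → p i ∈ S) ∧
    (∀ i, i + 1 < n → Γ.Adj (p i) (p (i + 1))) ∧ ∀ i, i + 2 < n → p i ≠ p (i + 2)
  have hind : ∀ (n : ℕ) (p : ℕ → N), (∀ i, i + 1 < n → Γ.Adj (p i) (p (i + 1))) →
      (∀ i, i + 2 < n → p i ≠ p (i + 2)) →
      (∀ i j, i < n → j < n → π (p i) = π (p j) → i = j) ∧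
      (∀ i j, i < n → j < n → (G.Adj (π (p i)) (π (p j)) ↔ i + 1 = j ∨ j + 1 = i)) := by
    intro n p h1 h2
    have h3 := hG.induced_of_local (p := fun i => π (p i)) (n := n)
      (fun i hi => hhom _ _ (h1 i hi))
      (fun i hi => hloc (p (i + 1)) _ _ (h1 i (by omega)).symm (h1 (i + 1) (by omega)) (h2 i hi))
    have h4 : ∀ i j, i < j → j < n → π (p i) ≠ π (p j) ∧
        (G.Adj (π (p i)) (π (p j)) → i + 1 = j) := by
      intro i j hij hj
      obtain ⟨l, rfl⟩ : ∃ l, j = i + (l + 1) := ⟨j - i - 1, by omega⟩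
      exact ⟨(h3 l i hj).1, fun h => by have := (h3 l i hj).2 h; omega⟩
    refine ⟨fun i j hi hj h => ?_, fun i j hi hj => ⟨fun h => ?_, ?_⟩⟩
    · rcases lt_trichotomy i j with hij | hij | hij
      · exact absurd h (h4 i j hij hj).1
      · exact hij
      · exact absurd h.symm (h4 j i hij hi).1
    · rcases lt_trichotomy i j with hij | hij | hij
      · exact Or.inl ((h4 i j hij hj).2 h)
      · exact absurd (hij ▸ rfl) h.ne
      · exact Or.inr ((h4 j i hij hi).2 h.symm)
    · rintro (rfl | rfl)
      · exact hhom _ _ (h1 i hj)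
      · exact (hhom _ _ (h1 j hi)).symm
  have hbd : ∀ n, Ch n → n ≤ Fintype.card V := by
    rintro n ⟨p, -, h1, h2⟩
    have hi := (hind n p h1 h2).1
    simpa using Fintype.card_le_of_injective (fun i : Fin n => π (p i))
      (fun i j h => Fin.ext (hi i j i.2 j.2 h))
  have hCh1 : Ch 1 := by
    obtain ⟨a, ha⟩ := hne
    exact ⟨fun _ => a, fun _ _ => ha, fun i hi => by omega, fun i hi => by omega⟩
  obtain ⟨n, hn, hmax⟩ : ∃ n, Ch n ∧ ∀ m, Ch m → m ≤ n := by
    refine ⟨Nat.findGreatest Ch (Fintype.card V), Nat.findGreatest_spec (hbd 1 hCh1) hCh1,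
      fun m hm => Nat.le_findGreatest (hbd m hm) hm⟩
  have hn1 := hmax 1 hCh1
  obtain ⟨p, hpS, h1, h2⟩ := hn
  refine ⟨n, p, hn1, hpS, h1, ?_, hind n p h1 h2⟩
  intro i b hi hb
  by_contra! hcon
  have hbS := hS _ (hpS i hi) b hb
  have hlong : ¬ Ch (n + 1) := fun h => by have := hmax _ h; omega
  rcases Nat.lt_or_ge (i + 1) n with hlast | hlast
  · rcases i with _ | i
    · refine hlong ⟨fun j => if j = 0 then b else p (j - 1), ?_, ?_, ?_⟩
      · intro j hj
        dsimp only
        split_ifs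
        · exact hbS
        · exact hpS _ (by omega)
      · intro j hj
        rcases j with _ | j
        · simpa using hb.symm
        · simpa using h1 j (by omega)
      · intro j hj
        rcases j with _ | j
        · simpa using hcon 1 hlast
        · simpa using h2 j (by omega)
    · rcases hdeg _ _ _ _ (h1 i (by omega)).symm (h1 (i + 1) hlast) hb with h | h | h
      · exact h2 i hlast h
      · exact hcon i (by omega) h.symm
      · exact hcon (i + 2) hlast h.symm
  · obtain rfl : n = i + 1 := by omega
    refine hlong ⟨fun j => if j < i + 1 then p j else b, ?_, ?_, ?_⟩
    · intro j hj
      dsimp only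
      split_ifs with hj'
      · exact hpS _ hj'
      · exact hbS
    · intro j hj
      have hj' : j < i + 1 := by omega
      simp only [hj', if_true]
      split_ifs with hj''
      · exact h1 j hj''
      · obtain rfl : j = i := by omega
        exact hb
    · intro j hj
      have hj' : j < i + 1 := by omega
      simp only [hj', if_true]
      split_ifs with hj''
      · exact h2 j hj''
      · exact (hcon j hj').symm

theorem SimpleGraph.xi_fst {V : Type*} (G : SimpleGraph V) (W : Finset V) (v : V) :
    (G.xi W).1 v = if v ∈ W then 1 else 0 := rfl

theorem SimpleGraph.xi_snd_of_adj {V : Type*} {G : SimpleGraph V} (W : Finset V) {u v : V}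
    (h : G.Adj u v) : (G.xi W).2 s(u, v) = if u ∈ W ∧ v ∈ W then 1 else 0 := by
  simp [SimpleGraph.xi, h]

theorem SimpleGraph.xi_snd_of_notMem {V : Type*} {G : SimpleGraph V} (W : Finset V) {e : Sym2 V}
    (h : e ∉ G.edgeSet) : (G.xi W).2 e = 0 := by
  simp [SimpleGraph.xi, h]

/-- The closed sets of `Γ`, as in `SimpleGraph.Chordal.exists_component`, decompose into induced
paths of `G`, with the vertices of `Γ` and its adjacencies counted by the extended incidence
vectors. -/
theorem SimpleGraph.Chordal.exists_decomposition {V N : Type*} [Fintype V] {G : SimpleGraph V}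
    (hG : G.Chordal) (Γ : SimpleGraph N) (π : N → V)
    (hhom : ∀ a b, Γ.Adj a b → G.Adj (π a) (π b))
    (hloc : ∀ a b c, Γ.Adj a b → Γ.Adj a c → b ≠ c → π b ≠ π c ∧ ¬ G.Adj (π b) (π c))
    (hdeg : ∀ a b c d, Γ.Adj a b → Γ.Adj a c → Γ.Adj a d → b = c ∨ b = d ∨ c = d)
    (U : Finset N) (S : Finset N) (hSU : S ⊆ U) (hS : ∀ a ∈ S, ∀ b, Γ.Adj a b → b ∈ S) :
    ∃ L : List (Finset V), (∀ W ∈ L, G.IsInducedPath W) ∧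
      (∀ v, (L.map G.xi).sum.1 v = ∑ a ∈ S, if π a = v then (1 : ℝ) else 0) ∧
      ∀ u v, G.Adj u v → (L.map G.xi).sum.2 s(u, v) =
        ∑ a ∈ S, if π a = u then (#{b ∈ U | Γ.Adj a b ∧ π b = v} : ℝ) else 0 := by
  induction S using Finset.strongInduction with
  | H S ih =>
    rcases S.eq_empty_or_nonempty with rfl | hne
    · exact ⟨[], by simp, by simp, by simp⟩
    obtain ⟨n, p, hn, hpS, hp1, hclosed, hinj, hadj⟩ :=
      hG.exists_component Γ π hhom hloc hdeg S hS hne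
    set P := (Finset.range n).image p with hP
    have hPmem : ∀ b, b ∈ P ↔ ∃ i, i < n ∧ p i = b := by
      intro b
      simp [hP]
    have hPS : P ⊆ S := by
      intro b hb
      obtain ⟨i, hi, rfl⟩ := (hPmem b).1 hb
      exact hpS i hi
    have hpinj : Set.InjOn p (Finset.range n : Set ℕ) := by
      intro i hi j hj h
      simp only [Finset.coe_range, Set.mem_Iio] at hi hj
      exact hinj i j hi hj (congrArg π h)
    obtain ⟨L, hL, hLv, hLe⟩ := ih (S \ P)
      (Finset.sdiff_ssubset hPS ⟨p 0, (hPmem _).2 ⟨0, hn, rfl⟩⟩)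
      (Finset.sdiff_subset.trans hSU) (by
        intro a ha b hab
        rw [Finset.mem_sdiff] at ha ⊢
        refine ⟨hS a ha.1 b hab, fun hb => ha.2 ?_⟩
        obtain ⟨i, hi, rfl⟩ := (hPmem b).1 hb
        obtain ⟨j, hj, rfl⟩ := hclosed i a hi hab.symm
        exact (hPmem _).2 ⟨j, hj, rfl⟩)
    set W := (Finset.range n).image fun i => π (p i) with hW
    have hWmem : ∀ v, v ∈ W ↔ ∃ i, i < n ∧ π (p i) = v := by
      intro v
      simp [hW]
    have hsumP : ∀ g : N → ℝ, ∑ a ∈ P, g a = ∑ i ∈ Finset.range n, g (p i) :=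
      fun g => Finset.sum_image hpinj
    have hsingle : ∀ (i : ℕ) (g : N → ℝ), i < n →
        ∑ a ∈ P, (if π a = π (p i) then g a else 0) = g (p i) := by
      intro i g hi
      rw [hsumP, Finset.sum_eq_single i]
      · simp
      · intro j hj hji
        exact if_neg fun h => hji (hinj j i (Finset.mem_range.1 hj) hi h)
      · intro h
        exact absurd (Finset.mem_range.2 hi) h
    have hzero : ∀ (v : V) (g : N → ℝ), v ∉ W → ∑ a ∈ P, (if π a = v then g a else 0) = 0 := by
      intro v g hv
      rw [hsumP]
      refine Finset.sum_eq_zero fun i hi => if_neg fun h => hv ?_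
      exact (hWmem v).2 ⟨i, Finset.mem_range.1 hi, h⟩
    refine ⟨W :: L, ?_, fun v => ?_, fun u v huv => ?_⟩
    · intro W' hW'
      rcases List.mem_cons.1 hW' with rfl | h
      · exact isInducedPath_iff.2 ⟨n, fun i => π (p i), hn, hinj, hadj, hW⟩
      · exact hL W' h
    · rw [← Finset.sum_sdiff hPS, ← hLv, List.map_cons, List.sum_cons, Prod.fst_add, Pi.add_apply,
        add_comm, xi_fst]
      congr 1
      split_ifs with hv
      · obtain ⟨i, hi, rfl⟩ := (hWmem v).1 hv
        exact (hsingle i (fun _ => 1) hi).symm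
      · exact (hzero v (fun _ => 1) hv).symm
    · rw [← Finset.sum_sdiff hPS, ← hLe u v huv, List.map_cons, List.sum_cons, Prod.snd_add,
        Pi.add_apply, add_comm, xi_snd_of_adj W huv]
      congr 1
      by_cases hu : u ∈ W
      · obtain ⟨i, hi, rfl⟩ := (hWmem u).1 hu
        rw [hsingle i (fun a => (#{b ∈ U | Γ.Adj a b ∧ π b = v} : ℝ)) hi]
        by_cases hv : v ∈ W
        · obtain ⟨j, hj, rfl⟩ := (hWmem v).1 hv
          have hΓ : Γ.Adj (p i) (p j) := by
            rcases (hadj i j hi hj).1 huv with rfl | rfl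
            · exact hp1 i hj
            · exact (hp1 j hi).symm
          have h1 : ({b ∈ U | Γ.Adj (p i) b ∧ π b = π (p j)} : Finset N) = {p j} := by
            ext b
            simp only [Finset.mem_filter, Finset.mem_singleton]
            constructor
            · rintro ⟨-, hb, hbπ⟩
              obtain ⟨l, hl, rfl⟩ := hclosed i b hi hb
              rw [hinj l j hl hj hbπ]
            · rintro rfl
              exact ⟨hSU (hpS j hj), hΓ, rfl⟩
          rw [h1, if_pos ⟨hu, hv⟩]
          simp
        · rw [if_neg fun h => hv h.2, Finset.filter_eq_empty_iff.2]
          · simp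
          · rintro b - ⟨hb, rfl⟩
            obtain ⟨l, hl, rfl⟩ := hclosed i b hi hb
            exact hv ((hWmem _).2 ⟨l, hl, rfl⟩)
      · rw [if_neg fun h => hu h.1, hzero u _ hu]

/-- An induced path has one more vertex than edges. -/
theorem SimpleGraph.IsInducedPath.sum_sub_sum {V : Type*} [Fintype V] {G : SimpleGraph V}
    {W : Finset V} (hW : G.IsInducedPath W) :
    ∑ v, (G.xi W).1 v - ∑ e, (G.xi W).2 e = 1 := by
  obtain ⟨n, p, hn, hinj, hadj, rfl⟩ := isInducedPath_iff.1 hW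
  set W := (Finset.range n).image p with hWdef
  have hv : ∑ v, (G.xi W).1 v = n := by
    simp only [xi_fst, Finset.sum_boole, Finset.filter_univ_mem]
    rw [hWdef, Finset.card_image_of_injOn, Finset.card_range]
    intro i hi j hj h
    simp only [Finset.coe_range, Set.mem_Iio] at hi hj
    exact hinj i j hi hj h
  have he : ∑ e, (G.xi W).2 e = (n - 1 : ℕ) := by
    have h0 : ∑ e, (G.xi W).2 e =
        #({e | e ∈ G.edgeSet ∧ ∀ v ∈ e, v ∈ W} : Finset (Sym2 V)) := by
      rw [Finset.natCast_card_filter]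
      refine Finset.sum_congr rfl fun e _ => ?_
      simp only [SimpleGraph.xi]
      congr
    have h1 : ({e | e ∈ G.edgeSet ∧ ∀ v ∈ e, v ∈ W} : Finset (Sym2 V)) =
        (Finset.range (n - 1)).image fun i => s(p i, p (i + 1)) := by
      ext e
      induction e using Sym2.ind with
      | _ u v =>
        simp only [Finset.mem_filter, Finset.mem_univ, true_and, Finset.mem_image,
          Finset.mem_range, mem_edgeSet, Sym2.mem_iff]
        constructor
        · rintro ⟨huv, hW⟩
          obtain ⟨i, hi, rfl⟩ : ∃ i, i < n ∧ p i = u := by simpa [hWdef] using hW u (Or.inl rfl)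
          obtain ⟨j, hj, rfl⟩ : ∃ i, i < n ∧ p i = v := by simpa [hWdef] using hW v (Or.inr rfl)
          rcases (hadj i j hi hj).1 huv with rfl | rfl
          · exact ⟨i, by omega, rfl⟩
          · exact ⟨j, by omega, Sym2.eq_swap⟩
        · rintro ⟨i, hi, he⟩
          have hmem : ∀ j, j < n → p j ∈ W := fun j hj =>
            Finset.mem_image_of_mem p (Finset.mem_range.2 hj)
          have ha := (hadj i (i + 1) (by omega) (by omega)).2 (Or.inl rfl)
          rcases Sym2.eq_iff.1 he with ⟨rfl, rfl⟩ | ⟨rfl, rfl⟩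
          · refine ⟨ha, ?_⟩
            rintro w (rfl | rfl) <;> exact hmem _ (by omega)
          · refine ⟨ha.symm, ?_⟩
            rintro w (rfl | rfl) <;> exact hmem _ (by omega)
    rw [h0, h1, Finset.card_image_of_injOn, Finset.card_range]
    intro i hi j hj h
    simp only [Finset.coe_range, Set.mem_Iio] at hi hj
    rcases Sym2.eq_iff.1 h with h | h
    · exact hinj i j (by omega) (by omega) h.1
    · have h1 := hinj i (j + 1) (by omega) (by omega) h.1
      have h2 := hinj (i + 1) j (by omega) (by omega) h.2
      omega
  rw [hv, he, Nat.cast_sub hn]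
  simp

/-- Weights `c ≤ 2` which sum to at most 2 on each pair of distinct nonadjacent vertices have sum
at most 2 over the neighbours of a vertex in an induced path. -/
theorem SimpleGraph.IsInducedPath.sum_weight_le {V : Type*} [Fintype V] {G : SimpleGraph V}
    {W : Finset V} (hW : G.IsInducedPath W) (w : V) (c : V → ℕ) (hc : ∀ u, c u ≤ 2)
    (hc' : ∀ u v, u ≠ v → ¬ G.Adj u v → c u + c v ≤ 2)
    (hw : w ∈ W) : ∑ u ∈ W with G.Adj w u, c u ≤ 2 := by
  obtain ⟨n, p, hn, hinj, hadj, rfl⟩ := isInducedPath_iff.1 hW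
  obtain ⟨i, hi, rfl⟩ : ∃ i, i < n ∧ p i = w := by simpa using hw
  have hmem : ∀ u, u ∈ ((Finset.range n).image p).filter (G.Adj (p i)) →
      ∃ j, j < n ∧ p j = u ∧ (i + 1 = j ∨ j + 1 = i) := by
    intro u hu
    obtain ⟨hu, hau⟩ := Finset.mem_filter.1 hu
    obtain ⟨j, hj, rfl⟩ : ∃ j, j < n ∧ p j = u := by simpa using hu
    exact ⟨j, hj, rfl, (hadj i j hi hj).1 hau⟩
  set A := ((Finset.range n).image p).filter (G.Adj (p i)) with hA
  by_cases hone : ∃ a b, a ∈ A ∧ b ∈ A ∧ a ≠ b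
  · obtain ⟨a, b, ha, hb, hab⟩ := hone
    obtain ⟨j, hj, rfl, hij⟩ := hmem a ha
    obtain ⟨l, hl, rfl, hil⟩ := hmem b hb
    have hjl : j ≠ l := fun h => hab (h ▸ rfl)
    have hsub : A ⊆ {p j, p l} := by
      intro u hu
      obtain ⟨m, hm, rfl, him⟩ := hmem u hu
      have : m = j ∨ m = l := by omega
      rcases this with rfl | rfl <;> simp
    calc ∑ u ∈ A, c u ≤ ∑ u ∈ {p j, p l}, c u := Finset.sum_le_sum_of_subset hsub
      _ = c (p j) + c (p l) := Finset.sum_pair hab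
      _ ≤ 2 := hc' _ _ hab fun h => by
        have := (hadj j l hj hl).1 h
        omega
  · push Not at hone
    rcases A.eq_empty_or_nonempty with h | ⟨a, ha⟩
    · simp [h]
    · have : A = {a} := Finset.eq_singleton_iff_unique_mem.2 ⟨ha, fun b hb => hone b a hb ha⟩
      simpa [this] using hc a

/-- Inequalities valid on the `k`-th dilation of the induced path polytope. -/
structure SimpleGraph.PathInequalities {V : Type*} [Fintype V] (G : SimpleGraph V) (k : ℝ)
    (q : (V → ℝ) × (Sym2 V → ℝ)) : Prop where
  fst_nonneg : ∀ v, 0 ≤ q.1 v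
  snd_nonneg : ∀ e, 0 ≤ q.2 e
  snd_eq_zero : ∀ e, e ∉ G.edgeSet → q.2 e = 0
  sum_sub_sum : ∑ v, q.1 v - ∑ e, q.2 e = k
  sum_weight_le : ∀ (w : V) (c : V → ℕ), (∀ u, c u ≤ 2) →
    (∀ u v, u ≠ v → ¬ G.Adj u v → c u + c v ≤ 2) → ∑ u, (c u : ℝ) * q.2 s(w, u) ≤ 2 * q.1 w

theorem SimpleGraph.PathInequalities.smul_add_smul {V : Type*} [Fintype V] {G : SimpleGraph V}
    {k l : ℝ} {q r : (V → ℝ) × (Sym2 V → ℝ)} (hq : G.PathInequalities k q)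
    (hr : G.PathInequalities l r) {a b : ℝ} (ha : 0 ≤ a) (hb : 0 ≤ b) :
    G.PathInequalities (a * k + b * l) (a • q + b • r) where
  fst_nonneg v := add_nonneg (mul_nonneg ha (hq.fst_nonneg v)) (mul_nonneg hb (hr.fst_nonneg v))
  snd_nonneg e := add_nonneg (mul_nonneg ha (hq.snd_nonneg e)) (mul_nonneg hb (hr.snd_nonneg e))
  snd_eq_zero e he := by simp [hq.snd_eq_zero e he, hr.snd_eq_zero e he]
  sum_sub_sum := by
    rw [← hq.sum_sub_sum, ← hr.sum_sub_sum]
    simp only [Prod.fst_add, Prod.smul_fst, Prod.snd_add, Prod.smul_snd, Pi.add_apply,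
      Pi.smul_apply, smul_eq_mul, Finset.sum_add_distrib, ← Finset.mul_sum]
    ring
  sum_weight_le w c hc hc' := by
    have h1 := mul_le_mul_of_nonneg_left (hq.sum_weight_le w c hc hc') ha
    have h2 := mul_le_mul_of_nonneg_left (hr.sum_weight_le w c hc hc') hb
    simp only [Prod.fst_add, Prod.smul_fst, Prod.snd_add, Prod.smul_snd, Pi.add_apply,
      Pi.smul_apply, smul_eq_mul, mul_add, Finset.sum_add_distrib]
    simp only [mul_left_comm _ a, mul_left_comm _ b, ← Finset.mul_sum]
    linarith

theorem SimpleGraph.IsInducedPath.pathInequalities {V : Type*} [Fintype V] {G : SimpleGraph V}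
    {W : Finset V} (hW : G.IsInducedPath W) : G.PathInequalities 1 (G.xi W) where
  fst_nonneg v := by
    rw [xi_fst]
    positivity
  snd_nonneg e := by
    simp only [SimpleGraph.xi]
    positivity
  snd_eq_zero e he := xi_snd_of_notMem W he
  sum_sub_sum := hW.sum_sub_sum
  sum_weight_le w c hc hc' := by
    have hterm : ∀ u, (c u : ℝ) * (G.xi W).2 s(w, u) =
        if w ∈ W ∧ u ∈ W ∧ G.Adj w u then (c u : ℝ) else 0 := by
      intro u
      by_cases h : G.Adj w u
      · simp [xi_snd_of_adj W h, h]
      · simp [xi_snd_of_notMem W (e := s(w, u)) (by simpa using h), h]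
    simp only [hterm, xi_fst]
    by_cases hw : w ∈ W
    · have := hW.sum_weight_le w c hc hc' hw
      simp only [hw, true_and, if_true]
      rw [← Finset.sum_filter]
      have h1 : (Finset.univ.filter fun u => u ∈ W ∧ G.Adj w u) = W.filter (G.Adj w) := by
        ext u
        simp
      rw [h1, mul_one]
      exact_mod_cast this
    · simp [hw]

theorem SimpleGraph.pathInequalities_of_mem {V : Type*} [Fintype V] {G : SimpleGraph V}
    {q : (V → ℝ) × (Sym2 V → ℝ)} (hq : q ∈ G.inducedPathPolytope) : G.PathInequalities 1 q := by
  refine convexHull_min (t := {q | G.PathInequalities 1 q}) ?_ ?_ hq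
  · rintro _ ⟨W, hW, rfl⟩
    exact hW.pathInequalities
  · intro q hq r hr a b ha hb hab
    have := hq.smul_add_smul hr ha hb
    rwa [mul_one, mul_one, hab] at this

/-- A natural-valued point satisfying the path inequalities of a chordal graph is a sum of
extended incidence vectors of induced paths. -/
theorem SimpleGraph.Chordal.exists_list_of_pathInequalities {V : Type*} [Fintype V]
    {G : SimpleGraph V} (hG : G.Chordal) {k : ℝ} {q : (V → ℝ) × (Sym2 V → ℝ)}
    (hq : G.PathInequalities k q) (x : V → ℕ) (y : Sym2 V → ℕ) (hx : ∀ v, q.1 v = x v)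
    (hy : ∀ e, q.2 e = y e) :
    ∃ L : List (Finset V), (∀ W ∈ L, G.IsInducedPath W) ∧ (L.map G.xi).sum = q := by
  have hyadj : ∀ u v, 0 < y s(u, v) → G.Adj u v := by
    intro u v h
    by_contra hadj
    have := hq.snd_eq_zero s(u, v) (by simpa using hadj)
    rw [hy] at this
    have : y s(u, v) = 0 := by exact_mod_cast this
    omega
  have hslots := fun w => hG.exists_slots (fun u => y s(w, u)) (x w) (fun c hc hc' => by
    have := hq.sum_weight_le w c hc hc'
    simp only [hx, hy] at this
    exact_mod_cast this)
  choose s hs1 hs2 hs3 using hslots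
  let Γ : SimpleGraph (V × ℕ) :=
    { Adj := fun a b => ∃ m, m < y s(a.1, b.1) ∧ s a.1 b.1 m = a.2 ∧ s b.1 a.1 m = b.2
      symm := ⟨fun a b ⟨m, h, h1, h2⟩ => ⟨m, Sym2.eq_swap (a := a.1) ▸ h, h2, h1⟩⟩
      loopless := ⟨fun a ⟨m, h, _⟩ => (hyadj a.1 a.1 (by omega)).ne rfl⟩ }
  let U : Finset (V × ℕ) := Finset.univ.biUnion fun v => (Finset.range (x v)).image (Prod.mk v)
  have hU : ∀ a, a ∈ U ↔ a.2 < x a.1 := by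
    rintro ⟨v, i⟩
    simp [U]
  have hΓU : ∀ a b, Γ.Adj a b → a ∈ U := by
    rintro a b ⟨m, hm, h1, -⟩
    rw [hU, ← h1]
    exact hs1 _ _ _ hm
  have hsumU : ∀ (u : V) (g : V × ℕ → ℝ),
      ∑ a ∈ U, (if a.1 = u then g a else 0) = ∑ i ∈ Finset.range (x u), g (u, i) := by
    intro u g
    rw [← Finset.sum_filter]
    refine (Finset.sum_bij (fun i _ => (u, i)) ?_ ?_ ?_ ?_).symm
    · intro i hi
      simpa [hU] using hi
    · intro i _ j _ h
      exact congrArg Prod.snd h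
    · rintro ⟨v, i⟩ h
      obtain ⟨h, rfl⟩ := Finset.mem_filter.1 h
      exact ⟨i, by simpa [hU] using h, rfl⟩
    · intro i _
      rfl
  obtain ⟨L, hL, hLv, hLe⟩ := hG.exists_decomposition Γ Prod.fst
    (fun a b ⟨m, hm, _⟩ => hyadj _ _ (by omega))
    (by
      rintro a b c ⟨m, hm, h1, h2⟩ ⟨m', hm', h1', h2'⟩ hbc
      refine (hs2 a.1 b.1 m c.1 m' hm hm' (h1.trans h1'.symm)).resolve_left ?_
      rintro ⟨h, rfl⟩
      exact hbc (Prod.ext h (by rw [← h2, ← h2', h])))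
    (by
      rintro a b c d ⟨m, hm, h1, h2⟩ ⟨m', hm', h1', h2'⟩ ⟨m'', hm'', h1'', h2''⟩
      refine (hs3 a.1 b.1 m c.1 m' d.1 m'' hm hm' hm'' (h1.trans h1'.symm)
        (h1.trans h1''.symm)).imp ?_ (Or.imp ?_ ?_)
      · rintro ⟨h, rfl⟩
        exact Prod.ext h (by rw [← h2, ← h2', h])
      · rintro ⟨h, rfl⟩
        exact Prod.ext h (by rw [← h2, ← h2'', h])
      · rintro ⟨h, rfl⟩
        exact Prod.ext h (by rw [← h2', ← h2'', h]))
    U U subset_rfl (fun a _ b hab => hΓU b a hab.symm)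
  have hzero : ∀ e, e ∉ G.edgeSet → (L.map G.xi).sum.2 e = 0 := by
    intro e he
    clear hL hLv hLe
    induction L with
    | nil => rfl
    | cons W L ih => simp [ih, xi_snd_of_notMem W he]
  refine ⟨L, hL, Prod.ext (funext fun v => ?_) (funext fun e => ?_)⟩
  · rw [hLv, hsumU v fun _ => 1, hx]
    simp
  · by_cases he : e ∈ G.edgeSet
    · induction e using Sym2.ind with
      | _ u v =>
        refine (hLe u v he).trans ((hsumU u _).trans ?_)
        rw [hy, ← Nat.cast_sum, ← Finset.card_sigma]
        congr 1
        rw [← Finset.card_range (y s(u, v))]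
        refine (Finset.card_bij
          (fun m _ => (⟨s u v m, (v, s v u m)⟩ : Σ _ : ℕ, V × ℕ)) ?_ ?_ ?_).symm
        · intro m hm
          have hm' := Finset.mem_range.1 hm
          have hadj : Γ.Adj (u, s u v m) (v, s v u m) := ⟨m, hm', rfl, rfl⟩
          simp only [Finset.mem_sigma, Finset.mem_range, Finset.mem_filter]
          exact ⟨hs1 u v m hm', hΓU _ _ hadj.symm, hadj, trivial⟩
        · intro m hm m' hm' h
          have h' : s u v m = s u v m' := congrArg Sigma.fst h
          rcases hs2 u v m v m' (Finset.mem_range.1 hm) (Finset.mem_range.1 hm') h' with h | h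
          · exact h.2
          · exact absurd rfl h.1
        · rintro ⟨i, b, j⟩ h
          simp only [Finset.mem_sigma, Finset.mem_range, Finset.mem_filter] at h
          obtain ⟨-, -, ⟨m, hm, h1, h2⟩, rfl⟩ := h
          simp only at h1 h2 hm
          exact ⟨m, Finset.mem_range.2 hm, by rw [h1, h2]⟩
    · rw [hzero e he, hq.snd_eq_zero e he]

open scoped Pointwise in
/-- the induced path polytope of a chordal graph has the integer
decomposition property. -/
theorem inducedPathPolytope_IDP {V : Type*} [Fintype V]
    (G : SimpleGraph V) (hG : G.Chordal) (k : ℕ) (hk : 0 < k)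
    (q : (V → ℝ) × (Sym2 V → ℝ)) (hq : q ∈ (k : ℝ) • G.inducedPathPolytope)
    (hx : ∀ v, ∃ n : ℤ, q.1 v = n) (hy : ∀ e, ∃ n : ℤ, q.2 e = n) :
    ∃ f : Fin k → Finset V, (∀ i, G.IsInducedPath (f i)) ∧ q = ∑ i, G.xi (f i) := by
  obtain ⟨r, hr, rfl⟩ := hq
  have hineq : G.PathInequalities k ((k : ℝ) • r) := by
    have hr' := SimpleGraph.pathInequalities_of_mem hr
    simpa using hr'.smul_add_smul hr' (Nat.cast_nonneg k) le_rfl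
  set q := (k : ℝ) • r
  have hnat : ∀ t : ℝ, 0 ≤ t → (∃ n : ℤ, t = n) → ∃ n : ℕ, t = n := by
    rintro _ h0 ⟨n, rfl⟩
    lift n to ℕ using by exact_mod_cast h0
    exact ⟨n, by simp⟩
  choose x hx' using fun v => hnat _ (hineq.fst_nonneg v) (hx v)
  choose y hy' using fun e => hnat _ (hineq.snd_nonneg e) (hy e)
  obtain ⟨L, hL, hLq⟩ := hG.exists_list_of_pathInequalities hineq x y hx' hy'
  have hlen : ∀ L : List (Finset V), (∀ W ∈ L, G.IsInducedPath W) →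
      ∑ v, (L.map G.xi).sum.1 v - ∑ e, (L.map G.xi).sum.2 e = L.length := by
    intro L
    induction L with
    | nil => simp
    | cons W L ih =>
      intro h
      have h1 := ih fun W' hW' => h W' (List.mem_cons_of_mem _ hW')
      have h2 := (h W List.mem_cons_self).sum_sub_sum
      simp only [List.map_cons, List.sum_cons, Prod.fst_add, Prod.snd_add, Pi.add_apply,
        Finset.sum_add_distrib, List.length_cons, Nat.cast_add, Nat.cast_one]
      linarith
  have hk' : L.length = k := by
    have := hlen L hL
    rw [hLq, hineq.sum_sub_sum] at this
    exact_mod_cast this.symm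
  subst hk'
  refine ⟨fun i => L[i], fun i => hL _ (List.getElem_mem _), ?_⟩
  exact hLq.symm.trans (Fin.sum_univ_fun_getElem L G.xi).symm
end

section
/- Let G be a finite simple graph. The induced path polytope of G (the convex hull of the extended incidence vectors of the induced paths of G) is equal to the polytope P(G) if and only if G is chordal. -/
open SimpleGraph Finset
open scoped Classical

namespace SimpleGraph

lemma cycleGraph_adj_iff_val {n : ℕ} (hn : 3 ≤ n) (u v : Fin n) :
    (cycleGraph n).Adj u v ↔ u.val + 1 = v.val ∨ v.val + 1 = u.val ∨
      (u.val = 0 ∧ v.val + 1 = n) ∨ (v.val = 0 ∧ u.val + 1 = n) := by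
  rw [cycleGraph_adj']
  have hu := u.isLt
  have hv := v.isLt
  rcases lt_trichotomy u v with h | h | h
  · rw [Fin.coe_sub_iff_lt.2 h, Fin.coe_sub_iff_le.2 h.le]
    rw [Fin.lt_def] at h
    omega
  · subst h
    rw [Fin.coe_sub_iff_le.2 le_rfl]
    omega
  · rw [Fin.coe_sub_iff_lt.2 h, Fin.coe_sub_iff_le.2 h.le]
    rw [Fin.lt_def] at h
    omega

lemma card_edgeFinset_pathGraph (m : ℕ) : #(pathGraph (m + 1)).edgeFinset = m := by
  have h : (pathGraph (m + 1)).edgeFinset =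
      univ.image fun i : Fin m => s(i.castSucc, i.succ) := by
    ext e
    induction e with
    | _ u v =>
      simp only [mem_edgeFinset, mem_edgeSet, pathGraph_adj, mem_image, mem_univ, true_and,
        Sym2.eq_iff, Fin.ext_iff, Fin.val_castSucc, Fin.val_succ]
      constructor
      · rintro (h | h)
        · exact ⟨⟨u, by omega⟩, Or.inl ⟨rfl, h⟩⟩
        · exact ⟨⟨v, by omega⟩, Or.inr ⟨rfl, h⟩⟩
      · rintro ⟨i, h | h⟩ <;> omega
  rw [h, card_image_of_injective, card_univ, Fintype.card_fin]
  intro i j hij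
  simp only [Sym2.eq_iff, Fin.ext_iff, Fin.val_castSucc, Fin.val_succ] at hij
  ext
  omega

lemma card_edgeFinset_cycleGraph {n : ℕ} (hn : 3 ≤ n) : #(cycleGraph n).edgeFinset = n := by
  obtain ⟨m, rfl⟩ := Nat.exists_eq_add_of_le' hn
  have h := (cycleGraph (m + 3)).sum_degrees_eq_twice_card_edges
  simp only [cycleGraph_degree_three_le, sum_const, card_univ, Fintype.card_fin,
    smul_eq_mul] at h
  convert (show #(cycleGraph (m + 3)).edgeFinset = m + 3 by omega)

variable {V : Type*} (G : SimpleGraph V)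

lemma xi_fst_apply (W : Finset V) (v : V) : (G.xi W).1 v = if v ∈ W then 1 else 0 := rfl

lemma xi_snd_mk (W : Finset V) (u v : V) :
    (G.xi W).2 s(u, v) = if G.Adj u v ∧ u ∈ W ∧ v ∈ W then 1 else 0 := by
  simp [xi]

variable {G} in
lemma isInducedPath_singleton (v : V) : G.IsInducedPath {v} := by
  refine ⟨1, le_rfl, ⟨⟨Fintype.equivOfCardEq (by simp), ?_⟩⟩⟩
  rintro ⟨a, ha⟩ ⟨b, hb⟩
  simp only [coe_singleton, Set.mem_singleton_iff] at ha hb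
  subst ha hb
  simp

variable {G} in
lemma fst_le_one_of_mem_inducedPathPolytope {p : (V → ℝ) × (Sym2 V → ℝ)}
    (hp : p ∈ G.inducedPathPolytope) (v : V) : p.1 v ≤ 1 := by
  have hc : Convex ℝ {p : (V → ℝ) × (Sym2 V → ℝ) | p.1 v ≤ 1} := by
    intro p hp q hq a b ha hb hab
    simp only [Set.mem_ofPred_eq, Prod.fst_add, Prod.smul_fst, Pi.add_apply, Pi.smul_apply,
      smul_eq_mul] at *
    nlinarith
  refine convexHull_min ?_ hc hp
  rintro _ ⟨W, hW, rfl⟩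
  rw [Set.mem_ofPred_eq, xi_fst_apply]
  split_ifs <;> norm_num

variable [Fintype V]

lemma sum_xi_fst (W : Finset V) : ∑ v, (G.xi W).1 v = #W := by
  simp [xi]

lemma sum_xi_snd (W : Finset V) :
    ∑ e, (G.xi W).2 e = #(G.induce (W : Set V)).edgeFinset := by
  have h := congrArg card (G.map_edgeFinset_induce (s := (W : Set V)))
  rw [card_map] at h
  have hxi : ∀ e, (G.xi W).2 e =
      if e ∈ G.edgeFinset ∩ (W : Set V).toFinset.sym2 then 1 else 0 := by
    intro e
    simp [xi, mem_sym2_iff]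
  rw [sum_congr rfl fun e _ => hxi e, sum_boole]
  refine congrArg _ (Eq.trans ?_ (h.symm.trans ?_))
  · congr 1
    ext e
    simp
  · congr!

/-- The extended incidence vector of a vertex set whose induced subgraph is triangle-free with
all degrees at most two lies in the induced path cone. -/
lemma xi_mem_inducedPathCone {W : Finset V}
    (htri : ∀ a ∈ W, ∀ b ∈ W, ∀ c ∈ W, G.Adj a b → G.Adj b c → ¬ G.Adj a c)
    (hdeg : ∀ w ∈ W, ∀ a ∈ W, ∀ b ∈ W, ∀ c ∈ W, G.Adj w a → G.Adj w b → G.Adj w c →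
      a = b ∨ a = c ∨ b = c) :
    G.xi W ∈ G.inducedPathCone := by
  refine ⟨fun v => ?_, fun e => ?_, fun e he => ?_, fun w K hK hc => ?_⟩
  · rw [xi_fst_apply]; split_ifs <;> norm_num
  · simp only [xi]; split_ifs <;> norm_num
  · simp [xi, he]
  simp only [xi_snd_mk, xi_fst_apply]
  by_cases hw : w ∈ W
  swap
  · simp [hw]
  simp only [hw, true_and, if_true, sum_boole]
  by_cases hKW : ∃ u ∈ K, u ∈ W
  · obtain ⟨u, huK, huW⟩ := hKW
    have hwu : G.Adj w u := hK huK
    have h1 : #{v ∈ G.completeTo (insert w K) | G.Adj w v ∧ v ∈ W} = 0 := by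
      rw [card_eq_zero, filter_eq_empty_iff]
      rintro v hv ⟨hwv, hvW⟩
      simp only [completeTo, mem_filter, mem_univ, true_and] at hv
      exact htri w hw u huW v hvW hwu (hv.2 u (by simp [huK])).symm hwv
    have h2 : #{v ∈ K | G.Adj w v ∧ v ∈ W} ≤ 1 := by
      rw [card_le_one]
      intro a ha b hb
      rw [mem_filter] at ha hb
      by_contra hab
      exact htri w hw a ha.2.2 b hb.2.2 ha.2.1 (hc ha.1 hb.1 hab) hb.2.1
    rw [h1]
    have : (#{v ∈ K | G.Adj w v ∧ v ∈ W} : ℝ) ≤ 1 := by exact_mod_cast h2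
    push_cast
    linarith
  · have h1 : #{v ∈ K | G.Adj w v ∧ v ∈ W} = 0 := by
      rw [card_eq_zero, filter_eq_empty_iff]
      rintro v hv ⟨hwv, hvW⟩
      exact hKW ⟨v, hv, hvW⟩
    have h2 : #{v ∈ G.completeTo (insert w K) | G.Adj w v ∧ v ∈ W} ≤ 2 := by
      by_contra! h
      obtain ⟨a, ha, b, hb, c, hc, h1, h2, h3⟩ := two_lt_card.1 h
      rw [mem_filter] at ha hb hc
      rcases hdeg w hw a ha.2.2 b hb.2.2 c hc.2.2 ha.2.1 hb.2.1 hc.2.1 with h | h | h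
      exacts [h1 h, h2 h, h3 h]
    rw [h1]
    have : (#{v ∈ G.completeTo (insert w K) | G.Adj w v ∧ v ∈ W} : ℝ) ≤ 2 := by
      exact_mod_cast h2
    push_cast
    linarith

variable {G}

/-- Transfer of the hypotheses of `xi_mem_inducedPathCone` along an isomorphism. -/
lemma xi_mem_inducedPathCone_of_iso {α : Type*} {H : SimpleGraph α} {W : Finset V}
    (e : G.induce (W : Set V) ≃g H)
    (htri : ∀ a b c, H.Adj a b → H.Adj b c → ¬ H.Adj a c)
    (hdeg : ∀ w a b c, H.Adj w a → H.Adj w b → H.Adj w c → a = b ∨ a = c ∨ b = c) :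
    G.xi W ∈ G.inducedPathCone := by
  have key : ∀ a (ha : a ∈ W) b (hb : b ∈ W), G.Adj a b → H.Adj (e ⟨a, ha⟩) (e ⟨b, hb⟩) := by
    intro a ha b hb hab
    exact e.map_adj_iff.2 hab
  have key' : ∀ a (ha : a ∈ W) b (hb : b ∈ W), e ⟨a, ha⟩ = e ⟨b, hb⟩ → a = b := by
    intro a ha b hb hab
    simpa using hab
  apply xi_mem_inducedPathCone
  · intro a ha b hb c hc hab hbc hac
    exact htri _ _ _ (key a ha b hb hab) (key b hb c hc hbc) (key a ha c hc hac)
  · intro w hw a ha b hb c hc hwa hwb hwc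
    exact (hdeg _ _ _ _ (key w hw a ha hwa) (key w hw b hb hwb) (key w hw c hc hwc)).imp
      (key' _ _ _ _) (Or.imp (key' _ _ _ _) (key' _ _ _ _))

lemma IsInducedPath.xi_mem_pathPolyP {W : Finset V} (hW : G.IsInducedPath W) :
    G.xi W ∈ G.pathPolyP := by
  obtain ⟨n, hn, ⟨e⟩⟩ := hW
  obtain ⟨m, rfl⟩ := Nat.exists_eq_add_of_le' hn
  refine ⟨xi_mem_inducedPathCone_of_iso e ?_ ?_, ?_⟩
  · simp only [pathGraph_adj]
    omega
  · simp only [pathGraph_adj, Fin.ext_iff]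
    omega
  · have h1 : #W = m + 1 := by simpa using Fintype.card_congr e.toEquiv
    rw [sum_xi_fst, sum_xi_snd, e.card_edgeFinset_eq, card_edgeFinset_pathGraph, h1]
    simp

lemma exists_xi_mem_inducedPathCone_of_hasHole (h : G.HasHole) :
    ∃ W : Finset V, W.Nonempty ∧ G.xi W ∈ G.inducedPathCone ∧
      ∑ v, (G.xi W).1 v - ∑ e, (G.xi W).2 e = 0 := by
  obtain ⟨W, n, hn, ⟨e⟩⟩ := h
  lift W to Finset V using W.toFinite
  have h1 : #W = n := by simpa using Fintype.card_congr e.toEquiv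
  refine ⟨W, card_pos.1 (by omega), xi_mem_inducedPathCone_of_iso e ?_ ?_, ?_⟩
  · simp only [cycleGraph_adj_iff_val (show 3 ≤ n by omega)]
    omega
  · simp only [cycleGraph_adj_iff_val (show 3 ≤ n by omega), Fin.ext_iff]
    omega
  · rw [sum_xi_fst, sum_xi_snd, e.card_edgeFinset_eq,
      card_edgeFinset_cycleGraph (by omega), h1, sub_self]

lemma convex_pathPolyP : Convex ℝ G.pathPolyP := by
  rintro p ⟨⟨hp1, hp2, hp3, hp4⟩, hp5⟩ q ⟨⟨hq1, hq2, hq3, hq4⟩, hq5⟩ a b ha hb hab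
  refine ⟨⟨fun v => ?_, fun e => ?_, fun e he => ?_, fun w K hK hc => ?_⟩, ?_⟩
  · exact add_nonneg (mul_nonneg ha (hp1 v)) (mul_nonneg hb (hq1 v))
  · exact add_nonneg (mul_nonneg ha (hp2 e)) (mul_nonneg hb (hq2 e))
  · simp [hp3 e he, hq3 e he]
  · have h1 := mul_le_mul_of_nonneg_left (hp4 w K hK hc) ha
    have h2 := mul_le_mul_of_nonneg_left (hq4 w K hK hc) hb
    simp only [Prod.snd_add, Prod.smul_snd, Pi.add_apply, Pi.smul_apply, smul_eq_mul,
      sum_add_distrib, ← mul_sum, Prod.fst_add, Prod.smul_fst]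
    linarith
  · simp only [Prod.snd_add, Prod.smul_snd, Pi.add_apply, Pi.smul_apply, smul_eq_mul,
      sum_add_distrib, ← mul_sum, Prod.fst_add, Prod.smul_fst]
    linear_combination a * hp5 + b * hq5 + hab

lemma inducedPathPolytope_subset_pathPolyP : G.inducedPathPolytope ⊆ G.pathPolyP := by
  apply convexHull_min _ convex_pathPolyP
  rintro _ ⟨W, hW, rfl⟩
  exact hW.xi_mem_pathPolyP

lemma chordal_of_inducedPathPolytope_eq (h : G.inducedPathPolytope = G.pathPolyP) :
    G.Chordal := by
  intro hh
  obtain ⟨W, ⟨v, hv⟩, ⟨hq1, hq2, hq3, hq4⟩, hq5⟩ := exists_xi_mem_inducedPathCone_of_hasHole hh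
  obtain ⟨⟨hp1, hp2, hp3, hp4⟩, hp5⟩ := (isInducedPath_singleton (G := G) v).xi_mem_pathPolyP
  have hmem : G.xi {v} + G.xi W ∈ G.pathPolyP := by
    refine ⟨⟨fun v => add_nonneg (hp1 v) (hq1 v), fun e => add_nonneg (hp2 e) (hq2 e),
      fun e he => ?_, fun w K hK hc => ?_⟩, ?_⟩
    · simp [hp3 e he, hq3 e he]
    · have h1 := hp4 w K hK hc
      have h2 := hq4 w K hK hc
      simp only [Prod.snd_add, Pi.add_apply, sum_add_distrib, Prod.fst_add]
      linarith
    · simp only [Prod.snd_add, Pi.add_apply, sum_add_distrib, Prod.fst_add]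
      linarith
  rw [← h] at hmem
  have := fst_le_one_of_mem_inducedPathPolytope hmem v
  simp [xi_fst_apply, hv] at this
  norm_num at this

end SimpleGraph

/-- A nonnegative weight `y` satisfying the weighted Hall condition for a symmetric relation `R`
is the vector of row sums of a nonnegative symmetric matrix supported on `R`. -/
lemma exists_symmetric_of_hall {α : Type*} [Fintype α] (R : α → α → Prop)
    (hR : ∀ a b, R a b → R b a) (y : α → ℝ) (hy : ∀ a, 0 ≤ y a)
    (h : ∀ S : Finset α, ∑ a ∈ S, y a ≤ ∑ b with ∃ a ∈ S, R a b, y b) :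
    ∃ L : α → α → ℝ, (∀ a b, 0 ≤ L a b) ∧ (∀ a b, L a b = L b a) ∧
      (∀ a b, L a b ≠ 0 → R a b) ∧ ∀ a, ∑ b, L a b = y a := by
  set C : Set (α → α → ℝ) :=
    {L | (∀ a b, 0 ≤ L a b) ∧ (∀ a b, ¬ R a b → L a b = 0) ∧ ∀ a, ∑ b, L a b = y a} with hC
  have hCc : IsCompact C := by
    apply (isCompact_Icc (a := (0 : α → α → ℝ)) (b := fun a _ => y a)).of_isClosed_subset
    · simp only [hC, Set.ofPred_and, Set.ofPred_forall]
      refine IsClosed.inter ?_ (IsClosed.inter ?_ ?_)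
      · exact isClosed_iInter fun a => isClosed_iInter fun b =>
          isClosed_le continuous_const (by fun_prop)
      · exact isClosed_iInter fun a => isClosed_iInter fun b => isClosed_iInter fun _ =>
          isClosed_eq (by fun_prop) continuous_const
      · exact isClosed_iInter fun a => isClosed_eq (by fun_prop) continuous_const
    · rintro L ⟨h1, -, h3⟩
      refine ⟨fun a b => h1 a b, fun a b => ?_⟩
      change L a b ≤ y a
      rw [← h3 a]
      exact single_le_sum (f := L a) (fun b _ => h1 a b) (mem_univ b)
  have hCn : C.Nonempty := by
    have key : ∀ a, ∃ r : α → ℝ, (∀ b, 0 ≤ r b) ∧ (∀ b, ¬ R a b → r b = 0) ∧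
        ∑ b, r b = y a := by
      intro a
      by_cases hab : ∃ b, R a b
      · obtain ⟨b, hb⟩ := hab
        refine ⟨Pi.single b (y a), fun c => ?_, fun c hc => ?_, by simp⟩
        · rw [Pi.single_apply]
          split_ifs
          exacts [hy a, le_rfl]
        · rw [Pi.single_apply, if_neg]
          rintro rfl
          exact hc hb
      · push Not at hab
        have := h {a}
        simp only [sum_singleton, mem_singleton, exists_eq_left, hab, filter_false,
          sum_empty] at this
        exact ⟨0, by simp, by simp, by simpa using le_antisymm (hy a) this⟩
    choose r h1 h2 h3 using key
    exact ⟨r, h1, h2, h3⟩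
  obtain ⟨L, ⟨hL0, hLR, hLy⟩, hmin⟩ := hCc.exists_isMinOn hCn
    (f := fun L => ∑ b, (∑ a, L a b - y b) ^ 2) (by fun_prop)
  set l : α → ℝ := fun b => ∑ a, L a b - y b with hl
  have hshift : ∀ a v v', L a v ≠ 0 → R a v' → l v ≤ l v' := by
    intro a v v' hav hav'
    by_contra! hlt
    have hne : v ≠ v' := by rintro rfl; exact lt_irrefl _ hlt
    have hpos : 0 < L a v := lt_of_le_of_ne (hL0 a v) (Ne.symm hav)
    set ε := min (L a v) ((l v - l v') / 2) with hε
    have hε0 : 0 < ε := lt_min hpos (by linarith)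
    have hε1 : ε ≤ L a v := min_le_left _ _
    have hε2 : ε ≤ (l v - l v') / 2 := min_le_right _ _
    set δ : α → ℝ := fun b => (if b = v' then 1 else 0) - (if b = v then 1 else 0) with hδ
    set L' : α → α → ℝ := fun c b => L c b + if c = a then ε * δ b else 0 with hL'
    have hmem : L' ∈ C := by
      refine ⟨fun c b => ?_, fun c b hcb => ?_, fun c => ?_⟩
      · simp only [hL', hδ]
        have := hL0 c b
        split_ifs with h1 h2 h3 h4
        · linarith
        · linarith
        · subst h1 h4
          linarith
        · linarith
        · linarith
      · simp only [hL', hδ, hLR c b hcb, zero_add]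
        split_ifs with h1 h2 h3 h4
        · simp
        · subst h1 h2; exact absurd hav' hcb
        · subst h1 h4; exact absurd (hLR _ _ hcb) hav
        · simp
        · rfl
      · have : ∑ b, δ b = 0 := by simp [hδ]
        simp only [hL', sum_add_distrib, hLy]
        split_ifs
        · rw [← mul_sum, this]; simp
        · simp
    have hle := hmin hmem
    simp only [Set.mem_ofPred_eq] at hle
    have h1 : ∀ b, ∑ c, L' c b - y b = l b + ε * δ b := by
      intro b
      simp only [hL', hl, sum_add_distrib, sum_ite_eq', mem_univ, if_true]
      ring
    have h2 : ∑ b, (l b + ε * δ b) ^ 2 =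
        ∑ b, l b ^ 2 + 2 * ε * ∑ b, l b * δ b + ε ^ 2 * ∑ b, δ b ^ 2 := by
      rw [mul_sum, mul_sum, ← sum_add_distrib, ← sum_add_distrib]
      exact sum_congr rfl fun b _ => by ring
    have h3 : ∑ b, l b * δ b = l v' - l v := by
      simp [hδ, mul_sub]
    have h4 : ∑ b, δ b ^ 2 = 2 := by
      have : ∀ b, δ b ^ 2 = (if b = v' then 1 else 0) + (if b = v then 1 else 0) := by
        intro b
        simp only [hδ]
        split_ifs with h1 h2
        · exact absurd (h2.symm.trans h1) hne
        all_goals norm_num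
      simp only [this, sum_add_distrib, sum_ite_eq', mem_univ, if_true]
      norm_num
    simp only [h1, h2, h3, h4] at hle
    change ∑ b, l b ^ 2 ≤ _ at hle
    nlinarith
  have hle : ∀ b, l b ≤ 0 := by
    by_contra! hT
    obtain ⟨b₀, hb₀⟩ := hT
    set T : Finset α := univ.filter fun b => 0 < l b with hTdef
    set S : Finset α := univ.filter fun a => ∃ v ∈ T, L a v ≠ 0 with hSdef
    have h1 : ∑ b with ∃ a ∈ S, R a b, y b ≤ ∑ b ∈ T, y b := by
      apply sum_le_sum_of_subset_of_nonneg
      · intro b hb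
        obtain ⟨a, ha, hab⟩ := (mem_filter.1 hb).2
        obtain ⟨v, hv, hav⟩ := (mem_filter.1 ha).2
        exact mem_filter.2 ⟨mem_univ _, (mem_filter.1 hv).2.trans_le (hshift a v b hav hab)⟩
      · exact fun b _ _ => hy b
    have h2 : ∑ b ∈ T, ∑ a, L a b ≤ ∑ a ∈ S, y a := by
      rw [sum_comm, ← sum_subset (subset_univ S)]
      · refine sum_le_sum fun a _ => ?_
        rw [← hLy a]
        exact sum_le_sum_of_subset_of_nonneg (subset_univ T) fun b _ _ => hL0 a b
      · intro a _ haS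
        refine sum_eq_zero fun b hb => ?_
        by_contra hab
        exact haS (mem_filter.2 ⟨mem_univ _, b, hb, hab⟩)
    have h3 : 0 < ∑ b ∈ T, l b :=
      sum_pos (fun b hb => (mem_filter.1 hb).2) ⟨b₀, mem_filter.2 ⟨mem_univ _, hb₀⟩⟩
    simp only [hl, sum_sub_distrib] at h3
    linarith [h S]
  have hsum : ∑ b, l b = 0 := by
    simp only [hl, sum_sub_distrib]
    rw [sum_comm]
    simp [hLy]
  have hl0 : ∀ b, ∑ a, L a b = y b := by
    intro b
    have := (sum_eq_zero_iff_of_nonpos fun b _ => hle b).1 hsum b (mem_univ b)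
    exact sub_eq_zero.1 this
  refine ⟨fun a b => (L a b + L b a) / 2, fun a b => ?_, fun a b => ?_, fun a b hab => ?_,
    fun a => ?_⟩
  · have := hL0 a b
    have := hL0 b a
    positivity
  · ring
  · by_contra hn
    exact hab (by simp [hLR a b hn, hLR b a fun h => hn (hR _ _ h)])
  · rw [← sum_div, sum_add_distrib, hLy, hl0]
    ring

namespace SimpleGraph

variable {V : Type*} {G : SimpleGraph V}

/-- The pairs of ends of a transition of an induced path through a vertex, where `none` stands
for the absence of a further neighbor. -/
def IsTransitionPair (G : SimpleGraph V) (a b : Option V) : Prop :=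
  ∀ u v, a = some u → b = some v → u ≠ v ∧ ¬ G.Adj u v

lemma IsTransitionPair.symm {a b : Option V} (h : G.IsTransitionPair a b) :
    G.IsTransitionPair b a :=
  fun u v hu hv => ⟨(h v u hv hu).1.symm, fun huv => (h v u hv hu).2 huv.symm⟩

lemma exists_transition_of_mem_inducedPathCone [Fintype V] {p : (V → ℝ) × (Sym2 V → ℝ)}
    (hp : p ∈ G.inducedPathCone) (w : V) :
    ∃ L : Option V → Option V → ℝ, (∀ a b, 0 ≤ L a b) ∧ (∀ a b, L a b = L b a) ∧
      (∀ a b, L a b ≠ 0 → G.IsTransitionPair a b) ∧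
      (∀ u, ∑ b, L (some u) b = p.2 s(w, u)) ∧ ∑ a, ∑ b, L a b = 2 * p.1 w := by
  obtain ⟨-, hp2, hp3, hp4⟩ := hp
  have hp3' : ∀ u, ¬ G.Adj w u → p.2 s(w, u) = 0 := fun u hu => hp3 _ (by simpa using hu)
  have hloc : ∀ S : Finset V, ∑ u ∈ S, p.2 s(w, u) +
      ∑ u with ∀ v ∈ S, v = u ∨ G.Adj v u, p.2 s(w, u) ≤ 2 * p.1 w := by
    intro S
    set K : Finset V := univ.filter fun u => G.Adj w u ∧ u ∈ S ∧ ∀ v ∈ S, v = u ∨ G.Adj v u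
      with hK
    refine le_trans ?_ (hp4 w K (fun u hu => (mem_filter.1 hu).2.1) fun u hu v hv huv => ?_)
    · have hsum : ∀ T : Finset V, ∑ u ∈ T, p.2 s(w, u) = ∑ u, if u ∈ T then p.2 s(w, u) else 0 :=
        fun T => by simp
      rw [hsum S, hsum (filter _ _), hsum (G.completeTo _), hsum K, mul_sum, ← sum_add_distrib,
        ← sum_add_distrib]
      refine sum_le_sum fun u _ => ?_
      by_cases hwu : G.Adj w u
      swap
      · simp [hp3' u hwu]
      have hu0 := hp2 s(w, u)
      have hKmem : u ∈ K ↔ u ∈ S ∧ ∀ v ∈ S, v = u ∨ G.Adj v u := by simp [hK, hwu]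
      have hC : u ∈ S ∨ (∀ v ∈ S, v = u ∨ G.Adj v u) → u ∉ K →
          u ∈ G.completeTo (insert w K) := by
        intro h huK
        refine mem_filter.2 ⟨mem_univ _, by simp [hwu.ne', huK], fun v hv => ?_⟩
        rcases mem_insert.1 hv with rfl | hvK
        · exact hwu.symm
        have hvK' := (mem_filter.1 hvK).2
        have hne : u ≠ v := by rintro rfl; exact huK hvK
        rcases h with h | h
        · exact (hvK'.2.2 u h).resolve_left hne
        · exact ((h v hvK'.2.1).resolve_left hne.symm).symm
      simp only [mem_filter, mem_univ, true_and]
      by_cases h1 : u ∈ S <;> by_cases h2 : ∀ v ∈ S, v = u ∨ G.Adj v u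
      · rw [if_pos h1, if_pos h2, if_pos (hKmem.2 ⟨h1, h2⟩)]
        split_ifs <;> linarith
      · have huK : u ∉ K := fun h => h2 (hKmem.1 h).2
        rw [if_pos h1, if_neg h2, if_neg huK, if_pos (hC (Or.inl h1) huK)]
        linarith
      · have huK : u ∉ K := fun h => h1 (hKmem.1 h).1
        rw [if_neg h1, if_pos h2, if_neg huK, if_pos (hC (Or.inr h2) huK)]
        linarith
      · rw [if_neg h1, if_neg h2]
        split_ifs <;> linarith
    · exact ((mem_filter.1 hv).2.2.2 u (mem_filter.1 hu).2.2.1).resolve_left huv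
  set y : Option V → ℝ := fun a => a.elim (2 * p.1 w - ∑ u, p.2 s(w, u)) fun u => p.2 s(w, u)
    with hy
  have hysum : ∑ a, y a = 2 * p.1 w := by
    simp [hy, Fintype.sum_option]
  have hy0 : ∀ a, 0 ≤ y a := by
    rintro (_ | u)
    · have := hloc univ
      have h0 : 0 ≤ ∑ u with ∀ v ∈ univ, v = u ∨ G.Adj v u, p.2 s(w, u) :=
        sum_nonneg fun u _ => hp2 _
      simp only [hy, Option.elim]
      linarith
    · exact hp2 _
  obtain ⟨L, h1, h2, h3, h4⟩ := exists_symmetric_of_hall G.IsTransitionPair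
    (fun _ _ h => h.symm) y hy0 (by
      intro S
      by_cases hS : none ∈ S
      · refine sum_le_sum_of_subset_of_nonneg (fun b _ => ?_) fun b _ _ => hy0 b
        refine mem_filter.2 ⟨mem_univ _, none, hS, ?_⟩
        intro u v hu
        simp at hu
      · have h := hloc (eraseNone S)
        have hSe : ∑ u ∈ eraseNone S, p.2 s(w, u) = ∑ a ∈ S, y a := by
          conv_rhs => rw [← erase_eq_of_notMem hS, ← map_some_eraseNone, sum_map]
          rfl
        rcases S.eq_empty_or_nonempty with rfl | ⟨a, ha⟩
        · simp
        obtain ⟨x, rfl⟩ : ∃ x, a = some x := by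
          cases a with
          | none => exact absurd ha hS
          | some x => exact ⟨x, rfl⟩
        have hsplit := sum_filter_add_sum_filter_not univ
          (fun b => ∃ a ∈ S, G.IsTransitionPair a b) y
        have hnot : ∑ b with ¬ ∃ a ∈ S, G.IsTransitionPair a b, y b ≤
            ∑ u with ∀ v ∈ eraseNone S, v = u ∨ G.Adj v u, p.2 s(w, u) := by
          rw [sum_filter, sum_filter, Fintype.sum_option, if_neg, zero_add]
          · refine sum_le_sum fun u _ => ?_
            split_ifs with hn hn' hn'
            · exact hp2 _
            · exact le_rfl
            · exact le_rfl
            · refine absurd (fun v hv => ?_) hn'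
              by_contra! hvu
              refine hn ⟨some v, mem_eraseNone.1 hv, ?_⟩
              rintro _ _ ⟨⟩ ⟨⟩
              exact hvu
          · rw [not_not]
            refine ⟨some x, ha, ?_⟩
            rintro _ _ _ ⟨⟩
        linarith)
  exact ⟨L, h1, h2, h3, fun u => h4 _, by simp [h4, hysum]⟩

/-- In a chordal graph, a walk all of whose subwalks of length two are induced paths is an
induced path. -/
lemma Chordal.ne_and_not_adj_of_locally_induced (hG : G.Chordal) {f : ℕ → V} {n : ℕ}
    (h1 : ∀ i, i + 1 < n → G.Adj (f i) (f (i + 1)))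
    (h2 : ∀ i, i + 2 < n → f i ≠ f (i + 2) ∧ ¬ G.Adj (f i) (f (i + 2))) :
    ∀ k i, i + (k + 2) < n → f i ≠ f (i + (k + 2)) ∧ ¬ G.Adj (f i) (f (i + (k + 2))) := by
  intro k
  induction k using Nat.strong_induction_on with
  | _ k ih =>
    intro i hi
    obtain _ | k := k
    · exact h2 i hi
    have hne : f i ≠ f (i + (k + 1 + 2)) := by
      intro heq
      have h := (ih k (by omega) i (by omega)).2
      rw [heq] at h
      exact h (h1 (i + (k + 2)) (by omega)).symm
    refine ⟨hne, fun hadj => ?_⟩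
    have key : ∀ a b, a < b → b ≤ k + 3 → f (i + a) ≠ f (i + b) ∧
        (G.Adj (f (i + a)) (f (i + b)) ↔ a + 1 = b ∨ a = 0 ∧ b = k + 3) := by
      intro a b hab hb
      rcases Nat.lt_or_ge (a + 1) b with hlt | hge
      · obtain ⟨m, rfl⟩ : ∃ m, b = a + (m + 2) := ⟨b - a - 2, by omega⟩
        by_cases hm : m = k + 1
        · obtain rfl : a = 0 := by omega
          subst hm
          rw [add_zero, zero_add]
          exact ⟨hne, iff_of_true hadj (by omega)⟩
        · have h := ih m (by omega) (i + a) (by omega)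
          rw [← add_assoc]
          exact ⟨h.1, iff_of_false h.2 (by omega)⟩
      · obtain rfl : b = a + 1 := by omega
        have h := h1 (i + a) (by omega)
        rw [← add_assoc]
        exact ⟨h.ne, iff_of_true h (by omega)⟩
    set g : Fin (k + 4) → V := fun a => f (i + a) with hg
    have hginj : Function.Injective g := by
      intro a b hab
      rcases lt_trichotomy a b with h | h | h
      · exact absurd hab (key a b h (by omega)).1
      · exact h
      · exact absurd hab.symm (key b a h (by omega)).1
    refine hG ⟨Set.range g, k + 4, by omega,
      ⟨RelIso.symm ⟨Equiv.ofInjective g hginj, ?_⟩⟩⟩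
    intro a b
    rw [cycleGraph_adj_iff_val (by omega)]
    change G.Adj (f (i + a)) (f (i + b)) ↔ _
    rcases lt_trichotomy a b with h | h | h
    · rw [(key a b h (by omega)).2]
      rw [Fin.lt_def] at h
      omega
    · subst h
      exact iff_of_false (G.irrefl) (by omega)
    · rw [G.adj_comm, (key b a h (by omega)).2]
      rw [Fin.lt_def] at h
      omega

end SimpleGraph

namespace SimpleGraph

variable {V : Type*} {G : SimpleGraph V}

/-- The vertex preceding `f i` on the path `f 0, f 1, …`, if any. -/
def pathPred (f : ℕ → V) (i : ℕ) : Option V := if i = 0 then none else some (f (i - 1))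

/-- The vertex following `f i` on the path `f 0, …, f (n - 1)`, if any. -/
def pathSucc (f : ℕ → V) (n i : ℕ) : Option V := if i + 1 < n then some (f (i + 1)) else none

/-- The transitions of the path `f 0, …, f (n - 1)`, traversed in both directions. -/
noncomputable def pathTransition (f : ℕ → V) (n : ℕ) (w : V) (a b : Option V) : ℝ :=
  ∑ i ∈ range n, if f i = w then
    (if a = pathPred f i ∧ b = pathSucc f n i then 1 else 0) +
      (if a = pathSucc f n i ∧ b = pathPred f i then 1 else 0) else 0

lemma pathTransition_nonneg (f : ℕ → V) (n : ℕ) (w : V) (a b : Option V) :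
    0 ≤ pathTransition f n w a b := by
  refine sum_nonneg fun i _ => ?_
  split_ifs <;> norm_num

lemma pathTransition_symm (f : ℕ → V) (n : ℕ) (w : V) (a b : Option V) :
    pathTransition f n w a b = pathTransition f n w b a := by
  refine sum_congr rfl fun i _ => ?_
  rw [add_comm]
  simp only [and_comm]

lemma pathTransition_ne_zero {f : ℕ → V} {n : ℕ} {w : V} {a b : Option V}
    (h : pathTransition f n w a b ≠ 0) : ∃ i < n, f i = w ∧
      (a = pathPred f i ∧ b = pathSucc f n i ∨ a = pathSucc f n i ∧ b = pathPred f i) := by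
  obtain ⟨i, hi, hne⟩ := exists_ne_zero_of_sum_ne_zero h
  refine ⟨i, mem_range.1 hi, ?_⟩
  by_contra hn
  apply hne
  split_ifs <;> simp_all

lemma pathTransition_self_pos {f : ℕ → V} {n i : ℕ} (hi : i < n) :
    0 < pathTransition f n (f i) (pathPred f i) (pathSucc f n i) := by
  refine sum_pos' (fun j _ => ?_) ⟨i, mem_range.2 hi, ?_⟩
  · split_ifs <;> norm_num
  · simp only [if_true, and_self]
    split_ifs <;> norm_num

/-- The sequence `f 0, …, f (n - 1)` is an induced path. -/
structure IsInducedPathSeq (G : SimpleGraph V) (f : ℕ → V) (n : ℕ) : Prop where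
  pos : 1 ≤ n
  inj : ∀ i < n, ∀ j < n, f i = f j → i = j
  adj_iff : ∀ i < n, ∀ j < n, (G.Adj (f i) (f j) ↔ i + 1 = j ∨ j + 1 = i)

namespace IsInducedPathSeq

variable {f : ℕ → V} {n : ℕ}

lemma isInducedPath (h : G.IsInducedPathSeq f n) : G.IsInducedPath ((range n).image f) := by
  refine ⟨n, h.pos, ⟨RelIso.symm ⟨Equiv.ofBijective
    (fun i : Fin n => ⟨f i, by simpa using ⟨i, i.isLt, rfl⟩⟩) ⟨?_, ?_⟩, ?_⟩⟩⟩
  · intro i j hij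
    exact Fin.ext (h.inj i i.isLt j j.isLt (congrArg Subtype.val hij))
  · rintro ⟨v, hv⟩
    obtain ⟨i, hi, rfl⟩ := mem_image.1 (mem_coe.1 hv)
    exact ⟨⟨i, mem_range.1 hi⟩, rfl⟩
  · intro i j
    rw [pathGraph_adj]
    exact h.adj_iff i i.isLt j j.isLt

lemma sum_range_ite (h : G.IsInducedPathSeq f n) {j : ℕ} (hj : j < n) (c : ℕ → ℝ) :
    ∑ i ∈ range n, (if f i = f j then c i else 0) = c j := by
  rw [sum_eq_single_of_mem j (mem_range.2 hj), if_pos rfl]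
  intro i hi hij
  exact if_neg fun heq => hij (h.inj i (mem_range.1 hi) j hj heq)

lemma pathTransition_apply (h : G.IsInducedPathSeq f n) {j : ℕ} (hj : j < n) (a b : Option V) :
    pathTransition f n (f j) a b =
      (if a = pathPred f j ∧ b = pathSucc f n j then 1 else 0) +
      (if a = pathSucc f n j ∧ b = pathPred f j then 1 else 0) :=
  h.sum_range_ite hj _

lemma pathTransition_eq_zero {w : V} (hw : w ∉ (range n).image f) (a b : Option V) :
    pathTransition f n w a b = 0 := by
  refine sum_eq_zero fun i hi => if_neg ?_
  rintro rfl
  exact hw (mem_image_of_mem f hi)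

lemma sum_sum_pathTransition [Fintype V] (h : G.IsInducedPathSeq f n) (w : V) :
    ∑ a, ∑ b, pathTransition f n w a b = 2 * (G.xi ((range n).image f)).1 w := by
  rw [xi_fst_apply]
  split_ifs with hw
  · obtain ⟨j, hj, rfl⟩ := mem_image.1 hw
    simp only [h.pathTransition_apply (mem_range.1 hj), sum_add_distrib, ite_and]
    simp
    norm_num
  · simp [pathTransition_eq_zero hw]

lemma sum_pathTransition [Fintype V] (h : G.IsInducedPathSeq f n) (w u : V) :
    ∑ b, pathTransition f n w (some u) b = (G.xi ((range n).image f)).2 s(w, u) := by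
  rw [xi_snd_mk]
  by_cases hw : w ∈ (range n).image f
  swap
  · simp [pathTransition_eq_zero hw, hw]
  obtain ⟨j, hj, rfl⟩ := mem_image.1 hw
  have hjn := mem_range.1 hj
  have hsum : ∑ b, pathTransition f n (f j) (some u) b =
      (if some u = pathPred f j then 1 else 0) + (if some u = pathSucc f n j then 1 else 0) := by
    simp only [h.pathTransition_apply hjn, sum_add_distrib, ite_and]
    simp
  rw [hsum]
  by_cases hu : u ∈ (range n).image f
  · obtain ⟨k, hk, rfl⟩ := mem_image.1 hu
    have hkn := mem_range.1 hk
    have h1 : some (f k) = pathPred f j ↔ k + 1 = j := by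
      rw [pathPred]
      split_ifs with h0
      · simp [h0]
      · rw [Option.some_inj]
        exact ⟨fun heq => by have := h.inj k hkn (j - 1) (by omega) heq; omega,
          fun heq => by rw [← heq, Nat.add_sub_cancel]⟩
    have h2 : some (f k) = pathSucc f n j ↔ j + 1 = k := by
      rw [pathSucc]
      split_ifs with h0
      · rw [Option.some_inj]
        exact ⟨fun heq => (h.inj k hkn (j + 1) h0 heq).symm, fun heq => by rw [heq]⟩
      · exact iff_of_false (by simp) (by omega)
    simp only [h1, h2, h.adj_iff j hjn k hkn, hw, hu, and_true]
    split_ifs <;> first | omega | norm_num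
  · rw [if_neg, if_neg, if_neg, add_zero]
    · exact fun hh => hu hh.2.2
    · rw [pathSucc]
      split_ifs with h0
      · rw [Option.some_inj]
        rintro rfl
        exact hu (mem_image_of_mem f (mem_range.2 h0))
      · simp
    · rw [pathPred]
      split_ifs with h0
      · simp
      · rw [Option.some_inj]
        rintro rfl
        exact hu (mem_image_of_mem f (mem_range.2 (by omega)))

end IsInducedPathSeq

/-- A compatible choice of nonnegative weights of transitions at all vertices. -/
structure IsTransitionSystem [Fintype V] (G : SimpleGraph V)
    (L : V → Option V → Option V → ℝ) : Prop where
  nonneg : ∀ w a b, 0 ≤ L w a b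
  symm : ∀ w a b, L w a b = L w b a
  pair : ∀ w a b, L w a b ≠ 0 → G.IsTransitionPair a b
  adj : ∀ w u b, L w (some u) b ≠ 0 → G.Adj w u
  sum_comm : ∀ w u, ∑ b, L w (some u) b = ∑ b, L u (some w) b

/-- A sequence `f 0, …, f (n - 1)` all of whose inner transitions have nonzero weight. -/
structure IsTransitionWalk [Fintype V] (L : V → Option V → Option V → ℝ) (f : ℕ → V) (n : ℕ) :
    Prop where
  edge : ∀ i, i + 1 < n → ∑ b, L (f i) (some (f (i + 1))) b ≠ 0
  inner : ∀ i, i + 2 < n → L (f (i + 1)) (some (f i)) (some (f (i + 2))) ≠ 0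

variable [Fintype V] {L : V → Option V → Option V → ℝ} {f : ℕ → V} {n : ℕ}

lemma IsTransitionWalk.isInducedPathSeq (hG : G.Chordal) (hL : G.IsTransitionSystem L)
    (h : IsTransitionWalk L f n) (hn : 1 ≤ n) : G.IsInducedPathSeq f n := by
  have hadj : ∀ i, i + 1 < n → G.Adj (f i) (f (i + 1)) := by
    intro i hi
    obtain ⟨b, -, hb⟩ := exists_ne_zero_of_sum_ne_zero (h.edge i hi)
    exact hL.adj _ _ _ hb
  have hfar := hG.ne_and_not_adj_of_locally_induced hadj
    fun i hi => hL.pair _ _ _ (h.inner i hi) _ _ rfl rfl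
  have key : ∀ i j, i < j → j < n → f i ≠ f j ∧ (G.Adj (f i) (f j) ↔ i + 1 = j) := by
    intro i j hij hj
    rcases Nat.lt_or_ge (i + 1) j with hlt | hge
    · obtain ⟨k, rfl⟩ : ∃ k, j = i + (k + 2) := ⟨j - i - 2, by omega⟩
      exact ⟨(hfar k i hj).1, iff_of_false (hfar k i hj).2 (by omega)⟩
    · obtain rfl : j = i + 1 := by omega
      exact ⟨(hadj i hj).ne, iff_of_true (hadj i hj) rfl⟩
  refine ⟨hn, fun i hi j hj hij => ?_, fun i hi j hj => ?_⟩
  · rcases lt_trichotomy i j with hlt | heq | hlt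
    · exact absurd hij (key i j hlt hj).1
    · exact heq
    · exact absurd hij.symm (key j i hlt hi).1
  · rcases lt_trichotomy i j with hlt | rfl | hlt
    · rw [(key i j hlt hj).2]
      omega
    · exact iff_of_false G.irrefl (by omega)
    · rw [G.adj_comm, (key j i hlt hi).2]
      omega

lemma IsInducedPathSeq.le_card (h : G.IsInducedPathSeq f n) : n ≤ Fintype.card V := by
  have := Fintype.card_le_of_injective (fun i : Fin n => f i)
    fun i j hij => Fin.ext (h.inj i i.isLt j j.isLt hij)
  simpa using this

lemma IsTransitionWalk.reverse (hL : G.IsTransitionSystem L) (h : IsTransitionWalk L f n) :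
    IsTransitionWalk L (fun i => f (n - 1 - i)) n := by
  refine ⟨fun i hi => ?_, fun i hi => ?_⟩
  · obtain ⟨k, rfl⟩ : ∃ k, n = i + k + 2 := ⟨n - i - 2, by omega⟩
    rw [show i + k + 2 - 1 - i = k + 1 by omega, show i + k + 2 - 1 - (i + 1) = k by omega,
      hL.sum_comm]
    exact h.edge k (by omega)
  · obtain ⟨k, rfl⟩ : ∃ k, n = i + k + 3 := ⟨n - i - 3, by omega⟩
    rw [show i + k + 3 - 1 - i = k + 2 by omega, show i + k + 3 - 1 - (i + 1) = k + 1 by omega,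
      show i + k + 3 - 1 - (i + 2) = k by omega, hL.symm]
    exact h.inner k (by omega)

lemma IsTransitionWalk.last_ne_zero (hL : G.IsTransitionSystem L)
    (h : IsTransitionWalk L f (n + 2)) (hmax : ∀ g, ¬ IsTransitionWalk L g (n + 3)) :
    L (f (n + 1)) (some (f n)) none ≠ 0 := by
  have hne := h.edge n (by omega)
  rw [hL.sum_comm] at hne
  obtain ⟨b, -, hb⟩ := exists_ne_zero_of_sum_ne_zero hne
  cases b with
  | none => exact hb
  | some u =>
    refine absurd ⟨fun i hi => ?_, fun i hi => ?_⟩ (hmax fun i => if i < n + 2 then f i else u)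
    · rcases Nat.lt_or_ge (i + 1) (n + 2) with hlt | hge
      · simp only [if_pos hlt, if_pos (show i < n + 2 by omega)]
        exact h.edge i hlt
      · obtain rfl : i = n + 1 := by omega
        simp only [if_neg (show ¬ n + 1 + 1 < n + 2 by omega), if_pos (show n + 1 < n + 2 by omega)]
        rw [hL.symm] at hb
        exact (sum_pos' (fun b _ => hL.nonneg _ _ b)
          ⟨_, mem_univ _, lt_of_le_of_ne (hL.nonneg _ _ _) (Ne.symm hb)⟩).ne'
    · rcases Nat.lt_or_ge (i + 2) (n + 2) with hlt | hge
      · simp only [if_pos hlt, if_pos (show i < n + 2 by omega),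
          if_pos (show i + 1 < n + 2 by omega)]
        exact h.inner i hlt
      · obtain rfl : i = n := by omega
        simp only [if_neg (lt_irrefl _), if_pos (show i < i + 2 by omega),
          if_pos (show i + 1 < i + 2 by omega)]
        exact hb

lemma IsTransitionSystem.exists_path (hG : G.Chordal) (hL : G.IsTransitionSystem L)
    {w : V} {a b : Option V} (hw : L w a b ≠ 0) :
    ∃ f n, G.IsInducedPathSeq f n ∧ ∀ i < n, L (f i) (pathPred f i) (pathSucc f n i) ≠ 0 := by
  by_cases hedge : ∃ w u b, L w (some u) b ≠ 0
  · obtain ⟨w, u, b, hb⟩ := hedge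
    have hbound : ∀ n, (∃ f, IsTransitionWalk L f n) → n ≤ Fintype.card V := by
      rintro n ⟨f, hf⟩
      rcases Nat.eq_zero_or_pos n with rfl | hn
      · exact Nat.zero_le _
      · exact (hf.isInducedPathSeq hG hL hn).le_card
    have h2 : ∃ f, IsTransitionWalk L f 2 := by
      refine ⟨fun i => if i = 0 then w else u, fun i hi => ?_, fun i hi => by omega⟩
      obtain rfl : i = 0 := by omega
      exact (sum_pos' (fun b _ => hL.nonneg _ _ b)
        ⟨_, mem_univ b, lt_of_le_of_ne (hL.nonneg _ _ _) (Ne.symm hb)⟩).ne'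
    obtain ⟨f, hf⟩ := Nat.findGreatest_spec (P := fun n => ∃ f, IsTransitionWalk L f n)
      (hbound 2 h2) h2
    have hle := Nat.le_findGreatest (P := fun n => ∃ f, IsTransitionWalk L f n)
      (hbound 2 h2) h2
    set N := Nat.findGreatest (fun n => ∃ f, IsTransitionWalk L f n) (Fintype.card V) with hN
    have hmax : ∀ g, ¬ IsTransitionWalk L g (N + 1) := by
      intro g hg
      have := Nat.le_findGreatest (P := fun n => ∃ f, IsTransitionWalk L f n)
        (hbound _ ⟨g, hg⟩) ⟨g, hg⟩
      omega
    obtain ⟨m, hm⟩ := Nat.exists_eq_add_of_le' hle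
    clear_value N
    subst hm
    refine ⟨f, m + 2, hf.isInducedPathSeq hG hL (by omega), fun i hi => ?_⟩
    have hlast := hf.last_ne_zero hL hmax
    have hfirst := (hf.reverse hL).last_ne_zero hL hmax
    simp only [show m + 2 - 1 - (m + 1) = 0 by omega, show m + 2 - 1 - m = 1 by omega] at hfirst
    rw [pathPred, pathSucc]
    split_ifs with h0 h1 h1
    · subst h0
      rw [hL.symm]
      exact hfirst
    · omega
    · obtain ⟨j, rfl⟩ := Nat.exists_eq_add_of_le' (Nat.pos_of_ne_zero h0)
      exact hf.inner j h1
    · obtain rfl : i = m + 1 := by omega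
      exact hlast
  · push Not at hedge
    have hnone : L w none none ≠ 0 := by
      cases a with
      | some u => exact absurd (hedge w u b) hw
      | none =>
        cases b with
        | some u => exact absurd (hedge w u none) (by rwa [hL.symm])
        | none => exact hw
    refine ⟨fun _ => w, 1, ⟨le_rfl, fun i hi j hj _ => by omega, fun i hi j hj =>
      iff_of_false G.irrefl (by omega)⟩, fun i hi => ?_⟩
    obtain rfl : i = 0 := by omega
    simpa [pathPred, pathSucc] using hnone

/-- In a chordal graph, every transition system is a nonnegative combination of induced paths. -/
lemma IsTransitionSystem.exists_decomposition (hG : G.Chordal) (hL : G.IsTransitionSystem L) :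
    ∃ μ : Finset V → ℝ, (∀ W, 0 ≤ μ W) ∧ (∀ W, μ W ≠ 0 → G.IsInducedPath W) ∧
      (∀ w, ∑ a, ∑ b, L w a b = 2 * ∑ W, μ W * (G.xi W).1 w) ∧
      ∀ w u, ∑ b, L w (some u) b = ∑ W, μ W * (G.xi W).2 s(w, u) := by
  induction hk : #{t : V × Option V × Option V | L t.1 t.2.1 t.2.2 ≠ 0}
    using Nat.strong_induction_on generalizing L with
  | _ k ih =>
    by_cases h0 : ∀ w a b, L w a b = 0
    · exact ⟨0, by simp, by simp, by simp [h0], by simp [h0]⟩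
    push Not at h0
    obtain ⟨w₀, a₀, b₀, hne⟩ := h0
    obtain ⟨f, n, hf, hpos⟩ := hL.exists_path hG hne
    set T := pathTransition f n with hT
    have hTL : ∀ w a b, T w a b ≠ 0 → L w a b ≠ 0 := by
      intro w a b h
      obtain ⟨i, hi, rfl, ⟨rfl, rfl⟩ | ⟨rfl, rfl⟩⟩ := pathTransition_ne_zero h
      · exact hpos i hi
      · rw [hL.symm]
        exact hpos i hi
    obtain ⟨t₀, ht₀, hmin⟩ := exists_min_image
      {t : V × Option V × Option V | T t.1 t.2.1 t.2.2 ≠ 0}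
      (fun t => L t.1 t.2.1 t.2.2 / T t.1 t.2.1 t.2.2)
      ⟨(f 0, pathPred f 0, pathSucc f n 0), by
        simpa using (pathTransition_self_pos hf.pos).ne'⟩
    simp only [mem_filter, mem_univ, true_and, Prod.forall] at ht₀ hmin
    set ε := L t₀.1 t₀.2.1 t₀.2.2 / T t₀.1 t₀.2.1 t₀.2.2 with hε
    have hT0 : ∀ w a b, 0 ≤ T w a b := pathTransition_nonneg f n
    have hε0 : 0 ≤ ε := div_nonneg (hL.nonneg _ _ _) (hT0 _ _ _)
    set L' : V → Option V → Option V → ℝ := fun w a b => L w a b - ε * T w a b with hL'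
    have hL'L : ∀ w a b, L' w a b ≠ 0 → L w a b ≠ 0 := by
      intro w a b h hz
      have : T w a b = 0 := by
        by_contra hTn
        exact hTL _ _ _ hTn hz
      exact h (by simp [hL', hz, this])
    have hsys : G.IsTransitionSystem L' := by
      refine ⟨fun w a b => ?_, fun w a b => ?_, fun w a b h => hL.pair w a b (hL'L _ _ _ h),
        fun w u b h => hL.adj w u b (hL'L _ _ _ h), fun w u => ?_⟩
      · by_cases hTz : T w a b = 0
        · simpa [hL', hTz] using hL.nonneg w a b
        · have hTp := lt_of_le_of_ne (hT0 w a b) (Ne.symm hTz)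
          exact sub_nonneg.2 ((le_div_iff₀ hTp).1 (hmin w a b hTz))
      · simp only [hL', hL.symm w a b, hT, pathTransition_symm f n w a b]
      · simp only [hL', sum_sub_distrib, ← mul_sum, hT, hf.sum_pathTransition, hL.sum_comm w u,
          Sym2.eq_swap (a := w)]
    have hlt : #{t : V × Option V × Option V | L' t.1 t.2.1 t.2.2 ≠ 0} < k := by
      rw [← hk]
      refine card_lt_card (Finset.ssubset_iff_subset_ne.2 ⟨fun t ht => ?_, fun heq => ?_⟩)
      · simp only [mem_filter, mem_univ, true_and] at ht ⊢
        exact hL'L _ _ _ ht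
      · have hmem := hTL _ _ _ ht₀
        have : t₀ ∈ ({t : V × Option V × Option V | L' t.1 t.2.1 t.2.2 ≠ 0} : Finset _) := by
          rw [heq]
          simpa using hmem
        simp only [mem_filter, mem_univ, true_and] at this
        apply this
        simp only [hL', hε]
        field_simp
        ring
    obtain ⟨μ, hμ0, hμp, hμx, hμy⟩ := ih _ hlt hsys rfl
    set W₀ := (range n).image f with hW₀
    refine ⟨fun W => μ W + if W = W₀ then ε else 0, fun W => ?_, fun W hW => ?_, fun w => ?_,
      fun w u => ?_⟩
    · have := hμ0 W
      beta_reduce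
      split_ifs <;> linarith
    · by_cases hWW : W = W₀
      · rw [hWW]
        exact hf.isInducedPath
      · exact hμp W (by simpa [hWW] using hW)
    · have h1 := hμx w
      have h2 := hf.sum_sum_pathTransition w
      simp only [hL', sum_sub_distrib, ← mul_sum] at h1
      simp only [add_mul, sum_add_distrib, ite_mul, zero_mul, sum_ite_eq', mem_univ, if_true]
      rw [hT, h2] at h1
      linarith
    · have h1 := hμy w u
      have h2 := hf.sum_pathTransition w u
      simp only [hL', sum_sub_distrib, ← mul_sum] at h1
      simp only [add_mul, sum_add_distrib, ite_mul, zero_mul, sum_ite_eq', mem_univ, if_true]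
      rw [hT, h2] at h1
      linarith

lemma Chordal.pathPolyP_subset (hG : G.Chordal) : G.pathPolyP ⊆ G.inducedPathPolytope := by
  rintro p ⟨hp, hp1⟩
  choose L h1 h2 h3 h4 h5 using exists_transition_of_mem_inducedPathCone hp
  have hsys : G.IsTransitionSystem L := by
    refine ⟨h1, h2, h3, fun w u b hb => ?_, fun w u => by rw [h4, h4, Sym2.eq_swap]⟩
    by_contra hwu
    have hsum := (h4 w u).trans (hp.2.2.1 _ (by simpa using hwu))
    exact hb ((sum_eq_zero_iff_of_nonneg fun b _ => h1 w _ b).1 hsum b (mem_univ b))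
  obtain ⟨μ, hμ0, hμp, hμx, hμy⟩ := hsys.exists_decomposition hG
  have hx : ∀ w, p.1 w = ∑ W, μ W * (G.xi W).1 w := by
    intro w
    linarith [h5 w, hμx w]
  have hy : ∀ e, p.2 e = ∑ W, μ W * (G.xi W).2 e := by
    intro e
    induction e with
    | _ w u => rw [← h4, hμy]
  have hpeq : ∑ W with G.IsInducedPath W, μ W • G.xi W = p := by
    rw [sum_filter_of_ne fun W _ hW => hμp W fun h => hW (by simp [h])]
    ext v
    · simp [Prod.fst_sum, hx]
    · simp [Prod.snd_sum, hy]
  have hone : ∑ W with G.IsInducedPath W, μ W = 1 := by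
    rw [sum_filter_of_ne fun W _ hW => hμp W hW, ← hp1]
    simp only [hx, hy]
    rw [sum_comm, sum_comm (s := univ (α := Sym2 V)), ← sum_sub_distrib]
    refine sum_congr rfl fun W _ => ?_
    rw [← mul_sum, ← mul_sum, ← mul_sub]
    by_cases hW : μ W = 0
    · simp [hW]
    · rw [(hμp W hW).xi_mem_pathPolyP.2, mul_one]
  rw [← hpeq]
  exact (convex_convexHull ℝ _).sum_mem (fun W _ => hμ0 W) hone fun W hW =>
    subset_convexHull ℝ _ ⟨W, (mem_filter.1 hW).2, rfl⟩

end SimpleGraph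

/-- the induced path polytope equals `P(G)` iff `G` is chordal. -/
theorem inducedPathPolytope_eq_iff_chordal {V : Type*} [Fintype V] (G : SimpleGraph V) :
    G.inducedPathPolytope = G.pathPolyP ↔ G.Chordal :=
  ⟨chordal_of_inducedPathPolytope_eq, fun hG =>
    inducedPathPolytope_subset_pathPolyP.antisymm hG.pathPolyP_subset⟩
end

section
/- Let G be a finite simple graph, w a vertex, and K ⊆ N(w) a clique that does not define an orbit of w; let K' ⊆ N(w) be a clique with K ⊊ K' and K ∪ {w} ∪ C_G(K∪{w}) ⊆ K' ∪ {w} ∪ C_G(K'∪{w}). Then the inequality associated with (w,K) is dominated: every (x,y) ∈ R^V × R^E with y ≥ 0 satisfying Σ_{u ∈ C_G(K'∪{w})} y_{wu} + 2 Σ_{u ∈ K'} y_{wu} ≤ 2 x_w also satisfies Σ_{u ∈ C_G(K∪{w})} y_{wu} + 2 Σ_{u ∈ K} y_{wu} ≤ 2 x_w. -/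
open SimpleGraph Finset
open scoped Classical

/-- the inequality associated with a non-orbit-defining clique `K` is
dominated by the one associated with the orbit-defining clique `K'` containing it. -/
theorem non_orbit_inequality_dominated {V : Type*} [Fintype V] (G : SimpleGraph V)
    (w : V) (K K' : Finset V)
    (hKN : (K : Set V) ⊆ G.neighborSet w) (hKc : G.IsClique (K : Set V))
    (hK'N : (K' : Set V) ⊆ G.neighborSet w) (hK'c : G.IsClique (K' : Set V))
    (hnotorbit : ¬ G.DefinesOrbit w K)
    (hss : K ⊂ K')
    (hincl : insert w K ∪ G.completeTo (insert w K) ⊆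
      insert w K' ∪ G.completeTo (insert w K'))
    (p : (V → ℝ) × (Sym2 V → ℝ)) (hy : ∀ e, 0 ≤ p.2 e)
    (h : ∑ u ∈ G.completeTo (insert w K'), p.2 s(w, u) +
        2 * ∑ u ∈ K', p.2 s(w, u) ≤ 2 * p.1 w) :
    ∑ u ∈ G.completeTo (insert w K), p.2 s(w, u) +
      2 * ∑ u ∈ K, p.2 s(w, u) ≤ 2 * p.1 w := by
  have hd : ∀ L : Finset V, Disjoint (G.completeTo (insert w L)) L := fun L ↦
    Finset.disjoint_left.2 fun u hu hL ↦
      (Finset.mem_filter.1 hu).2.1 (Finset.mem_insert_of_mem hL)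
  have hsub : G.completeTo (insert w K) ∪ K ⊆ G.completeTo (insert w K') ∪ K' := by
    intro u hu
    have huw : u ≠ w := by
      rintro rfl
      rcases Finset.mem_union.1 hu with hu | hu
      · exact (Finset.mem_filter.1 hu).2.1 (Finset.mem_insert_self _ _)
      · exact G.loopless.irrefl _ (hKN hu)
    have hmem := @hincl u
    simp only [Finset.mem_union, Finset.mem_insert] at hu hmem ⊢
    tauto
  have hnn : ∀ u, 0 ≤ p.2 s(w, u) := fun u ↦ hy _
  have hle := Finset.sum_le_sum_of_subset_of_nonneg hsub fun u _ _ ↦ hnn u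
  rw [Finset.sum_union (hd K), Finset.sum_union (hd K')] at hle
  have hle' := Finset.sum_le_sum_of_subset_of_nonneg hss.subset fun u _ _ ↦ hnn u
  linarith
end
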